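/- Let 0 < q₁ ≤ q₂ ≤ ∞, m, s, r ∈ ℝ with r > s + d(1/q₁ − 1/q₂). Then M^{∞,q₁}_{⟨·⟩^m⊗⟨·⟩^r}(ℝ^d) ↪ M^{∞,q₂}_{⟨·⟩^m⊗⟨·⟩^r}(ℝ^d) ↪ M^{∞,q₁}_{⟨·⟩^m⊗⟨·⟩^s}(ℝ^d), with continuous embeddings. -/

import Mathlib

open scoped Real BigOperators ENNReal
open Complex MeasureTheory

noncomputable section

/-- The Japanese bracket `⟨x⟩ = (1+|x|²)^{1/2}` with the Euclidean norm on `ℝ^d`. -/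
def jb {d : ℕ} (x : Fin d → ℝ) : ℝ := Real.sqrt (1 + ∑ i, (x i) ^ 2)

/-- The `M^{∞,q}_{⟨·⟩^m ⊗ ⟨·⟩^u}` (quasi-)norm of a "generalized STFT"
`V : ℝ^d → ℝ^d → ℂ`, for `0 < q ≤ ∞` encoded as `q : ℝ≥0∞`. -/
def modNorm {d : ℕ} (q : ℝ≥0∞) (m u : ℝ) (V : (Fin d → ℝ) → (Fin d → ℝ) → ℂ) : ℝ≥0∞ :=
  if q = ∞ then
    ⨆ ω, ⨆ x, (‖V x ω‖₊ : ℝ≥0∞) * ENNReal.ofReal (jb x ^ m) * ENNReal.ofReal (jb ω ^ u)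
  else
    (∫⁻ ω : Fin d → ℝ,
        (⨆ x, (‖V x ω‖₊ : ℝ≥0∞) * ENNReal.ofReal (jb x ^ m)) ^ q.toReal *
          ENNReal.ofReal (jb ω ^ u) ^ q.toReal) ^ (1 / q.toReal)

section SchwartzSeminorms

open SchwartzMap FourierTransform Topology

variable {V : Type*} [NormedAddCommGroup V] [NormedSpace ℝ V]

/-- The supremum of all Schwartz seminorms of indices at most `(M, M)`. -/
def schwartzNorm (V : Type*) [NormedAddCommGroup V] [NormedSpace ℝ V] (M : ℕ) :
    Seminorm ℝ 𝓢(V, ℂ) :=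
  (Finset.Iic (M, M)).sup fun m => SchwartzMap.seminorm ℝ m.1 m.2

lemma one_add_pow_mul_le_schwartzNorm {M j l : ℕ} (hj : j ≤ M) (hl : l ≤ M) (φ : 𝓢(V, ℂ))
    (y : V) : (1 + ‖y‖) ^ j * ‖iteratedFDeriv ℝ l φ y‖ ≤ 2 ^ M * schwartzNorm V M φ :=
  SchwartzMap.one_add_le_sup_seminorm_apply (m := (M, M)) hj hl φ y

lemma one_add_pow_mul_norm_le_schwartzNorm (M : ℕ) (φ : 𝓢(V, ℂ)) (y : V) :
    (1 + ‖y‖) ^ M * ‖φ y‖ ≤ 2 ^ M * schwartzNorm V M φ := by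
  simpa using one_add_pow_mul_le_schwartzNorm le_rfl (Nat.zero_le M) φ y

lemma schwartzNorm_le {M : ℕ} {φ : 𝓢(V, ℂ)} {K : ℝ} (hK : 0 ≤ K)
    (h : ∀ l ≤ M, ∀ y, (1 + ‖y‖) ^ M * ‖iteratedFDeriv ℝ l φ y‖ ≤ K) :
    schwartzNorm V M φ ≤ K := by
  refine Seminorm.finset_sup_apply_le hK fun i hi => ?_
  obtain ⟨h1, h2⟩ : i.1 ≤ M ∧ i.2 ≤ M := Finset.mem_Iic.1 hi
  refine SchwartzMap.seminorm_le_bound ℝ i.1 i.2 φ hK fun y => le_trans ?_ (h i.2 h2 y)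
  gcongr
  calc ‖y‖ ^ i.1 ≤ (1 + ‖y‖) ^ i.1 := by gcongr; linarith
    _ ≤ (1 + ‖y‖) ^ M := pow_le_pow_right₀ (by linarith [norm_nonneg y]) h1

lemma continuous_schwartzNorm (M : ℕ) : Continuous (schwartzNorm V M) := by
  refine Finset.sup_induction (p := fun q : Seminorm ℝ 𝓢(V, ℂ) => Continuous q) ?_ ?_ ?_
  · exact continuous_const
  · intro p hp q hq
    rw [Seminorm.coe_sup]
    exact hp.sup hq
  · exact fun i _ => (schwartz_withSeminorms ℝ V ℂ).continuous_seminorm i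

lemma Seminorm.exists_le_schwartzNorm (p : Seminorm ℝ 𝓢(V, ℂ)) (hp : Continuous p) :
    ∃ M : ℕ, ∃ C : ℝ, 0 < C ∧ ∀ φ, p φ ≤ C * schwartzNorm V M φ := by
  obtain ⟨s, C, hC, h⟩ := Seminorm.bound_of_continuous (schwartz_withSeminorms ℝ V ℂ) p hp
  obtain ⟨M, hM⟩ : ∃ M : ℕ, s ⊆ Finset.Iic (M, M) := by
    refine ⟨s.sup Prod.fst + s.sup Prod.snd, fun i hi => Finset.mem_Iic.2 (Prod.le_def.2 ⟨?_, ?_⟩)⟩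
    · exact (Finset.le_sup (f := Prod.fst) hi).trans (Nat.le_add_right _ _)
    · exact (Finset.le_sup (f := Prod.snd) hi).trans (Nat.le_add_left _ _)
  refine ⟨M, C, by positivity, fun φ => (h φ).trans ?_⟩
  rw [smul_apply]
  exact mul_le_mul_of_nonneg_left (Finset.sup_mono (f := schwartzSeminormFamily ℝ V ℂ) hM φ) C.2

lemma ContinuousLinearMap.exists_schwartzNorm_le (A : 𝓢(V, ℂ) →L[ℝ] 𝓢(V, ℂ)) (M : ℕ) :
    ∃ M' : ℕ, ∃ C : ℝ, 0 < C ∧ ∀ φ, schwartzNorm V M (A φ) ≤ C * schwartzNorm V M' φ :=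
  ((schwartzNorm V M).comp A.toLinearMap).exists_le_schwartzNorm
    ((continuous_schwartzNorm M).comp A.continuous)

lemma ContinuousLinearMap.exists_norm_le_schwartzNorm {G : Type*} [NormedAddCommGroup G]
    [NormedSpace ℝ G] (f : 𝓢(V, ℂ) →L[ℝ] G) :
    ∃ M : ℕ, ∃ C : ℝ, 0 < C ∧ ∀ φ, ‖f φ‖ ≤ C * schwartzNorm V M φ :=
  ((normSeminorm ℝ G).comp f.toLinearMap).exists_le_schwartzNorm
    (continuous_norm.comp f.continuous)

lemma schwartzNorm_mono {M M' : ℕ} (h : M ≤ M') (φ : 𝓢(V, ℂ)) :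
    schwartzNorm V M φ ≤ schwartzNorm V M' φ :=
  Finset.sup_mono (f := fun m : ℕ × ℕ => SchwartzMap.seminorm ℝ m.1 m.2 (E := V) (F := ℂ))
    (Finset.Iic_subset_Iic.2 (Prod.mk_le_mk.2 ⟨h, h⟩)) φ

lemma one_add_norm_le_mul {E : Type*} [SeminormedAddCommGroup E] (x y : E) :
    1 + ‖y‖ ≤ (1 + ‖x‖) * (1 + ‖y - x‖) := by
  have h : ‖y‖ ≤ ‖x‖ + ‖y - x‖ := by simpa using norm_add_le x (y - x)
  nlinarith [norm_nonneg x, norm_nonneg (y - x)]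

lemma iteratedFDeriv_compSubConstCLM (x : V) (φ : 𝓢(V, ℂ)) (l : ℕ) (y : V) :
    iteratedFDeriv ℝ l (compSubConstCLM ℝ x φ) y = iteratedFDeriv ℝ l φ (y - x) :=
  iteratedFDeriv_comp_sub l x y

lemma schwartzNorm_compSubConst_le (M : ℕ) (x : V) (φ : 𝓢(V, ℂ)) :
    schwartzNorm V M (compSubConstCLM ℝ x φ) ≤
      2 ^ M * (1 + ‖x‖) ^ M * schwartzNorm V M φ := by
  refine schwartzNorm_le (by positivity) fun l hl y => ?_
  rw [iteratedFDeriv_compSubConstCLM]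
  calc (1 + ‖y‖) ^ M * ‖iteratedFDeriv ℝ l φ (y - x)‖
      ≤ ((1 + ‖x‖) * (1 + ‖y - x‖)) ^ M * ‖iteratedFDeriv ℝ l φ (y - x)‖ := by
        gcongr; exact one_add_norm_le_mul x y
    _ = (1 + ‖x‖) ^ M * ((1 + ‖y - x‖) ^ M * ‖iteratedFDeriv ℝ l φ (y - x)‖) := by
        rw [mul_pow]; ring
    _ ≤ (1 + ‖x‖) ^ M * (2 ^ M * schwartzNorm V M φ) :=
        mul_le_mul_of_nonneg_left (one_add_pow_mul_le_schwartzNorm le_rfl hl φ _) (by positivity)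
    _ = _ := by ring

lemma schwartzNorm_compSubConst_sub_le (M : ℕ) (x : V) (φ : 𝓢(V, ℂ)) :
    schwartzNorm V M (compSubConstCLM ℝ x φ - φ) ≤
      2 ^ (M + 1) * (1 + ‖x‖) ^ M * schwartzNorm V (M + 1) φ * ‖x‖ := by
  refine schwartzNorm_le (by positivity) fun l hl y => ?_
  have hderiv : iteratedFDeriv ℝ l (compSubConstCLM ℝ x φ - φ : 𝓢(V, ℂ)) y =
      iteratedFDeriv ℝ l φ (y - x) - iteratedFDeriv ℝ l φ y := by
    have h1 : ContDiffAt ℝ l (compSubConstCLM ℝ x φ) y := (SchwartzMap.smooth _ l).contDiffAt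
    have h2 : ContDiffAt ℝ l φ y := (SchwartzMap.smooth _ l).contDiffAt
    rw [← iteratedFDeriv_compSubConstCLM, ← iteratedFDeriv_sub_apply h1 h2]
    rfl
  rw [hderiv]
  have hmv : ‖iteratedFDeriv ℝ l φ (y - x) - iteratedFDeriv ℝ l φ y‖ ≤
      ((1 + ‖x‖) ^ M * (2 ^ (M + 1) * schwartzNorm V (M + 1) φ) / (1 + ‖y‖) ^ M) *
        ‖(y - x) - y‖ := by
    refine Convex.norm_image_sub_le_of_norm_fderiv_le (𝕜 := ℝ) (s := segment ℝ y (y - x))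
      (fun z _ => ?_) (fun z hz => ?_) (convex_segment _ _) (left_mem_segment _ _ _)
      (right_mem_segment _ _ _)
    · exact ((φ.smooth ⊤).differentiable_iteratedFDeriv (mod_cast ENat.natCast_lt_top l)) z
    · rw [le_div_iff₀ (by positivity), norm_fderiv_iteratedFDeriv, mul_comm]
      have hyz : ‖y - z‖ ≤ ‖x‖ := by
        rw [segment_eq_image'] at hz
        obtain ⟨θ, ⟨h0, h1⟩, rfl⟩ := hz
        have : y - (y + θ • (y - x - y)) = θ • x := by
          simp
        rw [this, norm_smul, Real.norm_of_nonneg h0]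
        exact mul_le_of_le_one_left (norm_nonneg _) h1
      have hy : 1 + ‖y‖ ≤ (1 + ‖x‖) * (1 + ‖z‖) := by
        refine (one_add_norm_le_mul z y).trans ?_
        rw [mul_comm]; gcongr
      calc (1 + ‖y‖) ^ M * ‖iteratedFDeriv ℝ (l + 1) φ z‖
          ≤ ((1 + ‖x‖) * (1 + ‖z‖)) ^ M * ‖iteratedFDeriv ℝ (l + 1) φ z‖ := by gcongr
        _ = (1 + ‖x‖) ^ M * ((1 + ‖z‖) ^ M * ‖iteratedFDeriv ℝ (l + 1) φ z‖) := by
          rw [mul_pow]; ring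
        _ ≤ _ := mul_le_mul_of_nonneg_left (one_add_pow_mul_le_schwartzNorm (Nat.le_succ M)
          (Nat.succ_le_succ hl) φ z) (by positivity)
  refine (mul_le_mul_of_nonneg_left hmv (by positivity)).trans_eq ?_
  rw [show (y - x) - y = -x by abel, norm_neg]
  field_simp

lemma continuous_iff_schwartzNorm {T : Type*} [TopologicalSpace T] {F : T → 𝓢(V, ℂ)} :
    Continuous F ↔ ∀ t₀ M, Filter.Tendsto (fun t => schwartzNorm V M (F t - F t₀)) (𝓝 t₀) (𝓝 0) := by
  constructor
  · intro h t₀ M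
    have := ((continuous_schwartzNorm (V := V) M).comp (h.sub continuous_const)).tendsto t₀
      (f := fun t => schwartzNorm V M (F t - F t₀))
    simpa using this
  · intro h
    refine continuous_iff_continuousAt.2 fun t₀ => ?_
    refine ((schwartz_withSeminorms ℝ V ℂ).tendsto_nhds F (F t₀)).2 fun i ε hε => ?_
    filter_upwards [(h t₀ (max i.1 i.2)).eventually (gt_mem_nhds hε)] with t ht
    refine lt_of_le_of_lt ?_ ht
    exact Finset.le_sup (f := fun m : ℕ × ℕ => SchwartzMap.seminorm ℝ m.1 m.2 (E := V) (F := ℂ))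
      (b := i) (Finset.mem_Iic.2 (Prod.le_def.2 ⟨le_max_left _ _, le_max_right _ _⟩)) (F t - F t₀)

lemma Continuous.compSubConst {T : Type*} [TopologicalSpace T] {F : T → 𝓢(V, ℂ)} {x : T → V}
    (hx : Continuous x) (hF : Continuous F) :
    Continuous fun t => compSubConstCLM ℝ (x t) (F t) := by
  rw [continuous_iff_schwartzNorm] at hF ⊢
  intro t₀ M
  set φ := compSubConstCLM ℝ (x t₀) (F t₀) with hφ
  have hle : ∀ t, schwartzNorm V M (compSubConstCLM ℝ (x t) (F t) - φ) ≤
      2 ^ M * (1 + ‖x t‖) ^ M * schwartzNorm V M (F t - F t₀) +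
      2 ^ (M + 1) * (1 + ‖x t - x t₀‖) ^ M * schwartzNorm V (M + 1) φ * ‖x t - x t₀‖ := by
    intro t
    have : compSubConstCLM ℝ (x t) (F t) - φ = compSubConstCLM ℝ (x t) (F t - F t₀) +
        (compSubConstCLM ℝ (x t - x t₀) φ - φ) := by
      rw [hφ, compSubConstCLM_comp, map_sub]
      simp
    rw [this]
    exact (map_add_le_add _ _ _).trans (add_le_add (schwartzNorm_compSubConst_le _ _ _)
      (schwartzNorm_compSubConst_sub_le _ _ _))
  refine squeeze_zero (fun t => apply_nonneg _ _) hle ?_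
  have h1 : Filter.Tendsto (fun t => 2 ^ M * (1 + ‖x t‖) ^ M * schwartzNorm V M (F t - F t₀))
      (𝓝 t₀) (𝓝 (2 ^ M * (1 + ‖x t₀‖) ^ M * 0)) :=
    Filter.Tendsto.mul (Continuous.tendsto (by fun_prop) t₀) (hF t₀ M)
  have h2 : Filter.Tendsto (fun t => 2 ^ (M + 1) * (1 + ‖x t - x t₀‖) ^ M *
      schwartzNorm V (M + 1) φ * ‖x t - x t₀‖) (𝓝 t₀) (𝓝 (2 ^ (M + 1) * (1 + ‖x t₀ - x t₀‖) ^ M *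
      schwartzNorm V (M + 1) φ * ‖x t₀ - x t₀‖)) := Continuous.tendsto (by fun_prop) t₀
  simpa using h1.add h2

/-- The pointwise product of two Schwartz functions. -/
abbrev schwartzMul (a c : 𝓢(V, ℂ)) : 𝓢(V, ℂ) :=
  SchwartzMap.pairing (ContinuousLinearMap.mul ℝ ℂ) a c

lemma schwartzNorm_mul_compSubConst_le (M L : ℕ) (w : V) (a c : 𝓢(V, ℂ)) :
    (1 + ‖w‖) ^ L * schwartzNorm V M (schwartzMul a (compSubConstCLM ℝ w c)) ≤
      2 ^ M * (2 ^ (M + L) * schwartzNorm V (M + L) a) *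
        (2 ^ (M + L) * schwartzNorm V (M + L) c) := by
  rw [mul_comm, ← le_div_iff₀ (by positivity)]
  refine schwartzNorm_le (by positivity) fun l hl y => ?_
  rw [le_div_iff₀ (by positivity)]
  have hleib := norm_iteratedFDeriv_mul_le (𝕜 := ℝ) (a.smooth l)
    ((compSubConstCLM ℝ w c).smooth l) y (n := l) le_rfl
  have hw : 1 + ‖w‖ ≤ (1 + ‖y‖) * (1 + ‖y - w‖) := by
    simpa [norm_sub_rev] using one_add_norm_le_mul y w
  set A := 2 ^ (M + L) * schwartzNorm V (M + L) a
  set B := 2 ^ (M + L) * schwartzNorm V (M + L) c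
  have hA : 0 ≤ A := by positivity
  have hB : 0 ≤ B := by positivity
  calc (1 + ‖y‖) ^ M *
        ‖iteratedFDeriv ℝ l (schwartzMul a (compSubConstCLM ℝ w c)) y‖ * (1 + ‖w‖) ^ L
      ≤ (1 + ‖y‖) ^ M * (∑ i ∈ Finset.range (l + 1), (l.choose i : ℝ) *
          ‖iteratedFDeriv ℝ i a y‖ * ‖iteratedFDeriv ℝ (l - i) (compSubConstCLM ℝ w c) y‖) *
          ((1 + ‖y‖) * (1 + ‖y - w‖)) ^ L := by
        gcongr
        exact hleib
    _ = ∑ i ∈ Finset.range (l + 1), (l.choose i : ℝ) *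
          (((1 + ‖y‖) ^ (M + L) * ‖iteratedFDeriv ℝ i a y‖) *
           ((1 + ‖y - w‖) ^ L * ‖iteratedFDeriv ℝ (l - i) c (y - w)‖)) := by
        rw [Finset.mul_sum, Finset.sum_mul]
        refine Finset.sum_congr rfl fun i _ => ?_
        rw [iteratedFDeriv_compSubConstCLM, mul_pow]
        ring
    _ ≤ ∑ i ∈ Finset.range (l + 1), (l.choose i : ℝ) * (A * B) := by
        refine Finset.sum_le_sum fun i hi => ?_
        have hil : i ≤ l := Nat.lt_succ_iff.1 (Finset.mem_range.1 hi)
        gcongr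
        · exact one_add_pow_mul_le_schwartzNorm le_rfl (by omega) a y
        · exact one_add_pow_mul_le_schwartzNorm (by omega) (by omega) c _
    _ = 2 ^ l * (A * B) := by
        rw [← Finset.sum_mul]
        norm_cast
        rw [Nat.sum_range_choose]
    _ ≤ 2 ^ M * (A * B) := by
        gcongr
        norm_num
    _ = 2 ^ M * A * B := by ring

end SchwartzSeminorms

section WeakIntegral

open SchwartzMap Topology BoundedContinuousFunction

variable {V : Type*} [NormedAddCommGroup V] [NormedSpace ℝ V]

/-- The weighted derivative `y ↦ (1 + ‖y‖) ^ M • D^l φ y` as a bounded continuous function. -/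
def weightedDeriv (V : Type*) [NormedAddCommGroup V] [NormedSpace ℝ V] (M l : ℕ) :
    𝓢(V, ℂ) →L[ℝ] (V →ᵇ V [×l]→L[ℝ] ℂ) :=
  have hbound : ∀ (φ : 𝓢(V, ℂ)) (y : V), ‖(1 + ‖y‖) ^ M • iteratedFDeriv ℝ l φ y‖ ≤
      2 ^ M * (Finset.Iic (M, l)).sup (schwartzSeminormFamily ℝ V ℂ) φ := fun φ y => by
    rw [norm_smul, Real.norm_of_nonneg (by positivity)]
    exact SchwartzMap.one_add_le_sup_seminorm_apply (m := (M, l)) le_rfl le_rfl φ y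
  mkCLMtoNormedSpace
    (fun φ => ofNormedAddCommGroup (fun y => (1 + ‖y‖) ^ M • iteratedFDeriv ℝ l φ y)
      (by
        have := φ.smooth'.continuous_iteratedFDeriv (m := l) (mod_cast le_top)
        have h1 : Continuous fun y : V => (1 + ‖y‖) ^ M := by fun_prop
        exact h1.smul this)
      _ (hbound φ))
    (fun φ ψ => by
      ext1 y
      have h := iteratedFDeriv_add_apply (φ.smooth l).contDiffAt (ψ.smooth l).contDiffAt (x := y)
      exact (congrArg ((1 + ‖y‖) ^ M • ·) h).trans (smul_add _ _ _))
    (fun c φ => by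
      ext1 y
      have h := iteratedFDeriv_const_smul_apply (a := c) (φ.smooth l).contDiffAt (x := y)
      exact (congrArg ((1 + ‖y‖) ^ M • ·) h).trans (smul_comm _ _ _))
    ⟨Finset.Iic (M, l), 2 ^ M, by positivity, fun φ =>
      norm_ofNormedAddCommGroup_le _ (by positivity) (hbound φ)⟩

lemma weightedDeriv_apply (M l : ℕ) (φ : 𝓢(V, ℂ)) (y : V) :
    weightedDeriv V M l φ y = (1 + ‖y‖) ^ M • iteratedFDeriv ℝ l φ y := rfl

/-- The target of the map collecting all weighted derivatives of order at most `M`. -/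
def JetSpace (V : Type*) [NormedAddCommGroup V] [NormedSpace ℝ V] (M : ℕ) : Type _ :=
  ∀ l : Fin (M + 1), V →ᵇ V [×l]→L[ℝ] ℂ

instance (M : ℕ) : NormedAddCommGroup (JetSpace V M) :=
  Pi.normedAddCommGroup (G := fun l : Fin (M + 1) => V →ᵇ V [×l]→L[ℝ] ℂ)

instance (M : ℕ) : NormedSpace ℝ (JetSpace V M) :=
  Pi.normedSpace (E := fun l : Fin (M + 1) => V →ᵇ V [×l]→L[ℝ] ℂ)

instance (M : ℕ) : CompleteSpace (JetSpace V M) :=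
  inferInstanceAs (CompleteSpace (∀ l : Fin (M + 1), V →ᵇ V [×l]→L[ℝ] ℂ))

/-- Evaluation of a jet. -/
def JetSpace.eval (M : ℕ) (l : Fin (M + 1)) (y : V) : JetSpace V M →L[ℝ] V [×l]→L[ℝ] ℂ :=
  (evalCLM ℝ y).comp
    (ContinuousLinearMap.proj (R := ℝ) (φ := fun l : Fin (M + 1) => V →ᵇ V [×l]→L[ℝ] ℂ) l)

lemma JetSpace.ext_eval {M : ℕ} {a b : JetSpace V M} (h : ∀ l y, eval M l y a = eval M l y b) :
    a = b :=
  funext fun l => BoundedContinuousFunction.ext (h l)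

lemma JetSpace.norm_le {M : ℕ} {a : JetSpace V M} {K : ℝ} (hK : 0 ≤ K) :
    ‖a‖ ≤ K ↔ ∀ l y, ‖eval M l y a‖ ≤ K :=
  (pi_norm_le_iff_of_nonneg hK).trans
    (forall_congr' fun _ => BoundedContinuousFunction.norm_le hK)

/-- All weighted derivatives of order at most `M`. -/
def schwartzJet (V : Type*) [NormedAddCommGroup V] [NormedSpace ℝ V] (M : ℕ) :
    𝓢(V, ℂ) →L[ℝ] JetSpace V M :=
  ContinuousLinearMap.pi (φ := fun l : Fin (M + 1) => V →ᵇ V [×l]→L[ℝ] ℂ)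
    fun l => weightedDeriv V M l

lemma eval_schwartzJet (M : ℕ) (φ : 𝓢(V, ℂ)) (l : Fin (M + 1)) (y : V) :
    JetSpace.eval M l y (schwartzJet V M φ) = (1 + ‖y‖) ^ M • iteratedFDeriv ℝ l φ y := rfl

lemma schwartzNorm_le_norm_schwartzJet (M : ℕ) (φ : 𝓢(V, ℂ)) :
    schwartzNorm V M φ ≤ ‖schwartzJet V M φ‖ := by
  refine schwartzNorm_le (norm_nonneg _) fun l hl y => ?_
  refine le_trans ?_ ((JetSpace.norm_le (norm_nonneg _)).1 le_rfl ⟨l, Nat.lt_succ_iff.2 hl⟩ y)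
  rw [eval_schwartzJet, norm_smul, Real.norm_of_nonneg (by positivity)]

lemma schwartzJet_injective (M : ℕ) : Function.Injective (schwartzJet V M) := by
  refine (injective_iff_map_eq_zero _).2 fun φ h => ?_
  ext y
  have h1 := (one_add_pow_mul_norm_le_schwartzNorm M φ y).trans
    (mul_le_mul_of_nonneg_left (schwartzNorm_le_norm_schwartzJet M φ) (by positivity))
  rw [h, norm_zero, mul_zero] at h1
  have h2 : 0 < (1 + ‖y‖) ^ M := by positivity
  have h3 : ‖φ y‖ ≤ 0 := by nlinarith [norm_nonneg (φ y)]
  simpa using h3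

lemma ContinuousLinearMap.exists_eq_comp_schwartzJet (f : 𝓢(V, ℂ) →L[ℝ] ℝ) :
    ∃ M, ∃ f' : JetSpace V M →L[ℝ] ℝ,
      ∀ φ, f φ = f' (schwartzJet V M φ) := by
  obtain ⟨M, C, hC, h⟩ := f.exists_norm_le_schwartzNorm
  let e := LinearEquiv.ofInjective (schwartzJet V M).toLinearMap (schwartzJet_injective M)
  let f₀ : StrongDual ℝ (LinearMap.range (schwartzJet V M).toLinearMap) :=
    (f.toLinearMap ∘ₗ e.symm.toLinearMap).mkContinuous C fun z => by
      obtain ⟨φ, rfl⟩ := e.surjective z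
      simp only [LinearMap.comp_apply, LinearEquiv.coe_coe, LinearEquiv.symm_apply_apply]
      exact (h φ).trans (mul_le_mul_of_nonneg_left (schwartzNorm_le_norm_schwartzJet M φ) hC.le)
  obtain ⟨f', hf', -⟩ := exists_extension_norm_eq _ f₀
  refine ⟨M, f', fun φ => ?_⟩
  refine Eq.trans ?_ (hf' (e φ)).symm
  simp [f₀]

variable {T : Type*} [TopologicalSpace T] [SecondCountableTopology T] [MeasurableSpace T]
  [BorelSpace T] {μ : Measure T}

lemma integrable_of_schwartzNorm {F : T → 𝓢(V, ℂ)} (hF : Continuous F)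
    (hint : ∀ M, Integrable (fun t => schwartzNorm V M (F t)) μ)
    {G : Type*} [NormedAddCommGroup G] [NormedSpace ℝ G] (A : 𝓢(V, ℂ) →L[ℝ] G) :
    Integrable (fun t => A (F t)) μ := by
  obtain ⟨M, C, hC, h⟩ := A.exists_norm_le_schwartzNorm
  exact ((hint M).const_mul C).mono' (A.continuous.comp hF).aestronglyMeasurable
    (.of_forall fun t => h _)

lemma iteratedFDeriv_eq_integral {F : T → 𝓢(V, ℂ)} (hF : Continuous F)
    (hint : ∀ M, Integrable (fun t => schwartzNorm V M (F t)) μ) {h : 𝓢(V, ℂ)}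
    (hh : ∀ y, h y = ∫ t, F t y ∂μ) (l : ℕ) (y : V) :
    iteratedFDeriv ℝ l h y = ∫ t, iteratedFDeriv ℝ l (F t) y ∂μ := by
  have hI : ∀ l y, Integrable (fun t => iteratedFDeriv ℝ l (F t) y) μ := fun l y =>
    by simpa [weightedDeriv_apply] using
      integrable_of_schwartzNorm hF hint ((evalCLM (β := V [×l]→L[ℝ] ℂ) ℝ y).comp (weightedDeriv V 0 l))
  induction l generalizing y with
  | zero =>
    simp only [iteratedFDeriv_zero_eq_comp, Function.comp_apply, hh]
    exact ((continuousMultilinearCurryFin0 ℝ V ℂ).symm.toContinuousLinearEquiv.integral_comp_comm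
      _).symm
  | succ l ih =>
    have hline : ∀ (φ : 𝓢(V, ℂ)) (m : Fin (l + 1) → V) (c : ℝ),
        HasDerivAt (fun c : ℝ => iteratedFDeriv ℝ l φ (y + c • m 0) (Fin.tail m))
          (iteratedFDeriv ℝ (l + 1) φ (y + c • m 0) m) c := fun φ m c => by
      have h1 := ((φ.smooth ⊤).differentiable_iteratedFDeriv
        (mod_cast ENat.natCast_lt_top l) (y + c • m 0)).hasFDerivAt
      have h2 : HasDerivAt (fun c : ℝ => y + c • m 0) (m 0) c := by
        simpa using ((hasDerivAt_id c).smul_const (m 0)).const_add y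
      exact (ContinuousMultilinearMap.apply ℝ (fun _ : Fin l => V) ℂ
        (Fin.tail m)).hasFDerivAt.comp_hasDerivAt c (h1.comp_hasDerivAt c h2)
    have hIm : ∀ l y (m : Fin l → V), Integrable (fun t => iteratedFDeriv ℝ l (F t) y m) μ :=
      fun l y m => (ContinuousMultilinearMap.apply ℝ (fun _ : Fin l => V) ℂ m).integrable_comp
        (hI l y)
    ext m
    have key := hasDerivAt_integral_of_dominated_loc_of_deriv_le (μ := μ) (x₀ := (0 : ℝ))
      (F := fun c t => iteratedFDeriv ℝ l (F t) (y + c • m 0) (Fin.tail m))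
      (F' := fun c t => iteratedFDeriv ℝ (l + 1) (F t) (y + c • m 0) m)
      (bound := fun t => 2 ^ (l + 1) * schwartzNorm V (l + 1) (F t) * ∏ i, ‖m i‖)
      Filter.univ_mem (.of_forall fun c => (hIm l _ _).aestronglyMeasurable) (hIm l _ _)
      (hIm (l + 1) _ _).aestronglyMeasurable
      (.of_forall fun t c _ => ((iteratedFDeriv ℝ (l + 1) (F t) _).le_opNorm m).trans
        (mul_le_mul_of_nonneg_right (by
          simpa using one_add_pow_mul_le_schwartzNorm (Nat.zero_le _) le_rfl (F t)
            (y + c • m 0)) (by positivity)))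
      (((hint _).const_mul _).mul_const _) (.of_forall fun t c _ => hline (F t) m c)
    have hih : ∀ z, iteratedFDeriv ℝ l h z (Fin.tail m) =
        ∫ t, iteratedFDeriv ℝ l (F t) z (Fin.tail m) ∂μ := fun z => by
      rw [ih, ContinuousMultilinearMap.integral_apply (hI _ _)]
    have huniq := (hline h m 0).unique (key.2.congr_of_eventuallyEq (.of_forall fun c => hih _))
    rw [ContinuousMultilinearMap.integral_apply (hI _ _)]
    simpa using huniq

theorem ContinuousLinearMap.apply_eq_integral_of_schwartz
    {F : T → 𝓢(V, ℂ)} (hF : Continuous F)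
    (hint : ∀ M, Integrable (fun t => schwartzNorm V M (F t)) μ) {h : 𝓢(V, ℂ)}
    (hh : ∀ y, h y = ∫ t, F t y ∂μ) (f : 𝓢(V, ℂ) →L[ℝ] ℝ) :
    f h = ∫ t, f (F t) ∂μ := by
  obtain ⟨M, f', hf'⟩ := f.exists_eq_comp_schwartzJet
  simp_rw [hf']
  have hJ := integrable_of_schwartzNorm hF hint (schwartzJet V M)
  rw [f'.integral_comp_comm hJ]
  congr 1
  refine JetSpace.ext_eval fun l y => ?_
  rw [eval_schwartzJet, iteratedFDeriv_eq_integral hF hint hh, ← integral_smul]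
  exact (JetSpace.eval M l y).integral_comp_comm hJ

end WeakIntegral

section TimeFrequency

open SchwartzMap FourierTransform RealInnerProductSpace ComplexConjugate

variable {V : Type*} [NormedAddCommGroup V] [InnerProductSpace ℝ V] [FiniteDimensional ℝ V]
  [MeasurableSpace V] [BorelSpace V]

lemma fourierInv_compSubConst_apply (x : V) (φ : 𝓢(V, ℂ)) (ω : V) :
    𝓕⁻ (compSubConstCLM ℝ x φ) ω = cexp (2 * π * ⟪x, ω⟫ * I) * 𝓕⁻ φ ω := by
  rw [fourierInv_coe, fourierInv_coe, Real.fourierInv_eq', Real.fourierInv_eq',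
    ← integral_const_mul, ← integral_add_right_eq_self _ x]
  refine integral_congr_ae (.of_forall fun y => ?_)
  simp only [compSubConstCLM_apply, smul_eq_mul, ← mul_assoc, ← Complex.exp_add, inner_add_left,
    add_sub_cancel_right]
  congr 2
  push_cast
  ring

/-- The modulation operator, multiplication by `y ↦ exp (-2πi⟪ω, y⟫)`. -/
def modulation (ω : V) : 𝓢(V, ℂ) →L[ℝ] 𝓢(V, ℂ) :=
  (fourierInvCLM ℝ 𝓢(V, ℂ)) ∘L (compSubConstCLM ℝ (-ω)) ∘L (fourierCLM ℝ 𝓢(V, ℂ))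

lemma modulation_apply (ω : V) (φ : 𝓢(V, ℂ)) (y : V) :
    modulation ω φ y = cexp (-(2 * π * ⟪ω, y⟫ * I)) * φ y := by
  change 𝓕⁻ (compSubConstCLM ℝ (-ω) (𝓕 φ)) y = _
  rw [fourierInv_compSubConst_apply, fourierInv_fourier_eq, inner_neg_left]
  congr 2
  push_cast
  ring

/-- The time-frequency shift `y ↦ exp (-2πi⟪ω, y⟫) φ (y - x)`. -/
def tfShift (φ : 𝓢(V, ℂ)) (x ω : V) : 𝓢(V, ℂ) := modulation ω (compSubConstCLM ℝ x φ)

lemma tfShift_apply (φ : 𝓢(V, ℂ)) (x ω y : V) :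
    tfShift φ x ω y = cexp (-(2 * π * ⟪ω, y⟫ * I)) * φ (y - x) :=
  modulation_apply _ _ _

lemma modulation_tfShift (φ : 𝓢(V, ℂ)) (x ω ω₀ : V) :
    modulation ω₀ (tfShift φ x ω) = tfShift φ x (ω + ω₀) := by
  ext y
  rw [modulation_apply, tfShift_apply, tfShift_apply, ← mul_assoc, ← Complex.exp_add,
    inner_add_left]
  congr 2
  push_cast
  ring

lemma Continuous.modulation {T : Type*} [TopologicalSpace T] {F : T → 𝓢(V, ℂ)} {ω : T → V}
    (hω : Continuous ω) (hF : Continuous F) : Continuous fun t => modulation (ω t) (F t) :=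
  (fourierInvCLM ℝ 𝓢(V, ℂ)).continuous.comp
    (hω.neg.compSubConst ((fourierCLM ℝ 𝓢(V, ℂ)).continuous.comp hF))

lemma continuous_tfShift (φ : 𝓢(V, ℂ)) : Continuous fun p : V × V => tfShift φ p.1 p.2 :=
  continuous_snd.modulation (continuous_fst.compSubConst continuous_const)

lemma exists_schwartzNorm_modulation_le (M : ℕ) : ∃ M' : ℕ, ∃ C : ℝ, 0 < C ∧
    ∀ (ω : V) (φ : 𝓢(V, ℂ)),
      schwartzNorm V M (modulation ω φ) ≤ C * (1 + ‖ω‖) ^ M' * schwartzNorm V M' φ := by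
  obtain ⟨M₁, C₁, hC₁, h₁⟩ := (fourierInvCLM ℝ 𝓢(V, ℂ)).exists_schwartzNorm_le M
  obtain ⟨M₂, C₂, hC₂, h₂⟩ := (fourierCLM ℝ 𝓢(V, ℂ)).exists_schwartzNorm_le M₁
  refine ⟨max M₁ M₂, C₁ * (2 ^ M₁ * C₂), by positivity, fun ω φ => ?_⟩
  calc schwartzNorm V M (modulation ω φ)
      ≤ C₁ * (2 ^ M₁ * (1 + ‖-ω‖) ^ M₁ * (C₂ * schwartzNorm V M₂ φ)) := by
        refine (h₁ _).trans (mul_le_mul_of_nonneg_left ?_ hC₁.le)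
        exact (schwartzNorm_compSubConst_le M₁ (-ω) _).trans
          (mul_le_mul_of_nonneg_left (h₂ φ) (by positivity))
    _ = C₁ * (2 ^ M₁ * C₂) * (1 + ‖ω‖) ^ M₁ * schwartzNorm V M₂ φ := by rw [norm_neg]; ring
    _ ≤ _ := by
      gcongr
      · linarith [norm_nonneg ω]
      · exact le_max_left _ _
      · exact schwartzNorm_mono (le_max_right _ _) φ

lemma exists_schwartzNorm_tfShift_le (φ : 𝓢(V, ℂ)) (M : ℕ) : ∃ A : ℕ, ∃ C : ℝ, 0 < C ∧
    ∀ x ω, schwartzNorm V M (tfShift φ x ω) ≤ C * ((1 + ‖x‖) ^ A * (1 + ‖ω‖) ^ A) := by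
  obtain ⟨A, C, hC, h⟩ := exists_schwartzNorm_modulation_le (V := V) M
  refine ⟨A, C * (2 ^ A * (schwartzNorm V A φ + 1)), by positivity, fun x ω => ?_⟩
  calc _ ≤ C * (1 + ‖ω‖) ^ A * (2 ^ A * (1 + ‖x‖) ^ A * schwartzNorm V A φ) :=
        (h _ _).trans (mul_le_mul_of_nonneg_left (schwartzNorm_compSubConst_le _ _ _)
          (by positivity))
    _ ≤ C * (1 + ‖ω‖) ^ A * (2 ^ A * (1 + ‖x‖) ^ A * (schwartzNorm V A φ + 1)) := by
        gcongr
        linarith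
    _ = _ := by ring

/-- The real-valued function whose Fourier transform is `y ↦ W y + conj (W (-y))`. -/
def realSymbol (W : 𝓢(V, ℂ)) (ω : V) : ℝ := 2 * (𝓕⁻ W ω).re

lemma integral_realSymbol_smul (W : 𝓢(V, ℂ)) (y : V) (c : ℂ) :
    ∫ ω, realSymbol W ω • (cexp (-(2 * π * ⟪ω, y⟫ * I)) * c) = (W y + conj (W (-y))) * c := by
  have hF : ∀ z, ∫ ω, cexp (-(2 * π * ⟪ω, z⟫ * I)) * 𝓕⁻ W ω = W z := fun z => by
    conv_rhs => rw [← fourier_fourierInv_eq (F := 𝓢(V, ℂ)) W, fourier_coe, Real.fourier_eq']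
    refine integral_congr_ae (.of_forall fun ω => ?_)
    simp only [smul_eq_mul]
    congr 2
    push_cast
    ring
  have hI : ∀ z, Integrable fun ω => cexp (-(2 * π * ⟪ω, z⟫ * I)) * 𝓕⁻ W ω := fun z =>
    (modulation z (𝓕⁻ W)).integrable.congr (.of_forall fun ω => by
      simp only [modulation_apply, real_inner_comm])
  have hconj : ∀ ω, conj (cexp (-(2 * π * ⟪ω, -y⟫ * I)) * 𝓕⁻ W ω) =
      cexp (-(2 * π * ⟪ω, y⟫ * I)) * conj (𝓕⁻ W ω) := fun ω => by
    rw [map_mul, ← Complex.exp_conj]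
    simp [Complex.conj_ofNat]
  rw [← hF y, ← hF (-y), ← integral_conj, ← integral_add (hI y), ← integral_mul_const]
  · refine integral_congr_ae (.of_forall fun ω => ?_)
    simp only [hconj, realSymbol, ← mul_add, Complex.add_conj, real_smul]
    ring
  · simpa using ((conjCLE : ℂ →L[ℝ] ℂ).integrable_comp (hI (-y)))

lemma exists_realSymbol_le (N : ℕ) : ∃ M : ℕ, ∃ C : ℝ, 0 < C ∧ ∀ (W : 𝓢(V, ℂ)) (x ω : V),
    (1 + ‖ω‖) ^ N * ‖realSymbol (compSubConstCLM ℝ x W) ω‖ ≤ C * schwartzNorm V M W := by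
  obtain ⟨M, C, hC, h⟩ := (fourierInvCLM ℝ 𝓢(V, ℂ)).exists_schwartzNorm_le N
  refine ⟨M, 2 * (2 ^ N * C), by positivity, fun W x ω => ?_⟩
  have h1 : ‖realSymbol (compSubConstCLM ℝ x W) ω‖ ≤ 2 * ‖𝓕⁻ W ω‖ := by
    rw [realSymbol, fourierInv_compSubConst_apply, norm_mul, Real.norm_ofNat]
    gcongr
    refine (Complex.abs_re_le_norm _).trans_eq ?_
    rw [norm_mul, show (2 * π * ⟪x, ω⟫ * I : ℂ) = ((2 * π * ⟪x, ω⟫ : ℝ) : ℂ) * I by push_cast; rfl,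
      Complex.norm_exp_ofReal_mul_I, one_mul]
  calc _ ≤ (1 + ‖ω‖) ^ N * (2 * ‖𝓕⁻ W ω‖) := by gcongr
    _ = 2 * ((1 + ‖ω‖) ^ N * ‖𝓕⁻ W ω‖) := by ring
    _ ≤ 2 * (2 ^ N * (C * schwartzNorm V M W)) := by
      refine mul_le_mul_of_nonneg_left ?_ zero_le_two
      exact (one_add_pow_mul_norm_le_schwartzNorm N _ ω).trans
        (mul_le_mul_of_nonneg_left (h W) (by positivity))
    _ = _ := by ring

end TimeFrequency

section Reproducing

open SchwartzMap FourierTransform RealInnerProductSpace ComplexConjugate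

variable {V : Type*} [NormedAddCommGroup V] [InnerProductSpace ℝ V]

/-- Pointwise complex conjugation. -/
def conjCLM (V : Type*) [NormedAddCommGroup V] [NormedSpace ℝ V] : 𝓢(V, ℂ) →L[ℝ] 𝓢(V, ℂ) :=
  postcompCLM (conjCLE : ℂ →L[ℝ] ℂ)

lemma conjCLM_apply (φ : 𝓢(V, ℂ)) (y : V) : conjCLM V φ y = conj (φ y) := rfl

/-- The involution `φ ↦ conj (φ (-·))`. -/
def involution (V : Type*) [NormedAddCommGroup V] [NormedSpace ℝ V] : 𝓢(V, ℂ) →L[ℝ] 𝓢(V, ℂ) :=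
  conjCLM V ∘L compCLMOfContinuousLinearEquiv ℝ (ContinuousLinearEquiv.neg ℝ)

lemma involution_apply (φ : 𝓢(V, ℂ)) (y : V) : involution V φ y = conj (φ (-y)) := rfl

lemma involution_compSubConst (x : V) (φ : 𝓢(V, ℂ)) :
    involution V (compSubConstCLM ℝ x φ) = compSubConstCLM ℝ (-x) (involution V φ) := by
  ext y
  simp only [involution_apply, compSubConstCLM_apply]
  congr 2
  abel

variable [FiniteDimensional ℝ V] [MeasurableSpace V] [BorelSpace V]

lemma exists_dualWindow {b : 𝓢(V, ℂ)} (hb : b ≠ 0) : ∃ γ : 𝓢(V, ℂ), ∫ y, γ y * b y = 1 := by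
  have hint : Integrable fun y => conj (b y) * b y := (schwartzMul (conjCLM V b) b).integrable
  have hne : ∫ y, conj (b y) * b y ≠ 0 := fun h0 => hb <| by
    have hre : ∫ y, ‖b y‖ ^ 2 = 0 := by
      have h1 : ∀ y, conj (b y) * b y = ((‖b y‖ ^ 2 : ℝ) : ℂ) := fun y => by
        rw [mul_comm, Complex.mul_conj, Complex.normSq_eq_norm_sq]
      simp_rw [h1] at h0
      have h2 := integral_ofReal (𝕜 := ℂ) (μ := volume) (f := fun y => ‖b y‖ ^ 2)
      exact Complex.ofReal_eq_zero.1 (h2.symm.trans h0)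
    have hi : Integrable fun y => ‖b y‖ ^ 2 := by
      refine hint.norm.congr (.of_forall fun y => ?_)
      simp [sq]
    rw [integral_eq_zero_iff_of_nonneg (fun y => by positivity) hi] at hre
    have := (Continuous.ae_eq_iff_eq volume (b.continuous.norm.pow 2) continuous_const).1 hre
    ext y
    have h2 : ‖b y‖ ^ 2 = 0 := congrFun this y
    simpa using h2
  refine ⟨(∫ y, conj (b y) * b y)⁻¹ • conjCLM V b, ?_⟩
  simp only [smul_apply, conjCLM_apply, smul_eq_mul, mul_assoc]
  rw [integral_const_mul, inv_mul_cancel₀ hne]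

lemma exists_crossCorrelation (γ b : 𝓢(V, ℂ)) :
    ∃ ε : 𝓢(V, ℂ), ∀ y, ε y = ∫ z, conj (γ z) * b (y + y + z) := by
  refine ⟨compCLMOfContinuousLinearEquiv ℝ
    (ContinuousLinearEquiv.smulLeft (R₁ := ℝ) (Units.mk0 (2 : ℝ) two_ne_zero))
    (SchwartzMap.convolution (ContinuousLinearMap.mul ℂ ℂ) (involution V γ) b), fun y => ?_⟩
  rw [compCLMOfContinuousLinearEquiv_apply, Function.comp_apply, SchwartzMap.convolution_apply,
    MeasureTheory.convolution, ← integral_neg_eq_self]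
  refine integral_congr_ae (.of_forall fun z => ?_)
  simp [involution_apply, Units.smul_def, two_smul]

/-- The part of a shifted window which is synthesized from all its translates. -/
def innovation (ε h : 𝓢(V, ℂ)) : 𝓢(V, ℂ) := h - schwartzMul ε (involution V h)

/-- The part of a shifted window localized near the origin. -/
def localPart (ε : 𝓢(V, ℂ)) : 𝓢(V, ℂ) := schwartzMul ε (involution V ε)

lemma integral_localPart_tfShift (ε b : 𝓢(V, ℂ)) (x y : V) :
    schwartzMul (localPart ε) (compSubConstCLM ℝ x b) y =
      ∫ ω, (realSymbol ((1 / 2 : ℝ) • localPart ε) ω • tfShift b x ω) y := by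
  simp only [smul_apply, tfShift_apply]
  rw [integral_realSymbol_smul]
  simp [localPart, involution_apply, Complex.conj_ofNat]
  left
  ring

lemma integral_innovation_tfShift {γ b ε : 𝓢(V, ℂ)} (hγ : ∫ y, γ y * b y = 1)
    (hε : ∀ y, ε y = ∫ z, conj (γ z) * b (y + y + z)) (h : 𝓢(V, ℂ)) (y : V) :
    (h - schwartzMul (localPart ε) h) y =
      ∫ x, ∫ ω, (realSymbol (schwartzMul (innovation ε h) (compSubConstCLM ℝ x γ)) ω •
        tfShift b x ω) y := by
  set u := innovation ε h with hu
  simp only [smul_apply, tfShift_apply, integral_realSymbol_smul]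
  have hi1 : Integrable fun z => γ z * b z := (schwartzMul γ b).integrable
  have hi2 : Integrable fun z => conj (γ z) * b (y + y + z) :=
    (schwartzMul (conjCLM V γ) (compSubConstCLM ℝ (-(y + y)) b)).integrable.congr
      (.of_forall fun z => by
        simp [conjCLM_apply, add_comm, sub_eq_add_neg])
  have hsplit : ∀ x, (schwartzMul u (compSubConstCLM ℝ x γ) y +
      conj (schwartzMul u (compSubConstCLM ℝ x γ) (-y))) * b (y - x) =
      u y * (γ (y - x) * b (y - x)) +
        conj (u (-y)) * (conj (γ (-y - x)) * b (y + y + (-y - x))) := fun x => by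
    rw [show y + y + (-y - x) = y - x by abel]
    simp
    ring
  simp_rw [hsplit]
  rw [integral_add ((hi1.comp_sub_left y).const_mul _) ((hi2.comp_sub_left (-y)).const_mul _),
    integral_const_mul, integral_const_mul, integral_sub_left_eq_self (fun z => γ z * b z),
    integral_sub_left_eq_self (fun z => conj (γ z) * b (y + y + z)), hγ, ← hε]
  simp [hu, innovation, localPart, involution_apply]
  ring

lemma realSymbol_sub (W W' : 𝓢(V, ℂ)) (ω : V) :
    realSymbol (W - W') ω = realSymbol W ω - realSymbol W' ω := by
  have h : 𝓕⁻ (W - W') = 𝓕⁻ W - 𝓕⁻ W' := (fourierInvCLM ℝ 𝓢(V, ℂ)).map_sub W W'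
  rw [realSymbol, h, sub_apply, Complex.sub_re, mul_sub]
  rfl

lemma Continuous.realSymbol {T : Type*} [TopologicalSpace T] {W : T → 𝓢(V, ℂ)} {ω : T → V}
    (hW : Continuous W) (hω : Continuous ω) : Continuous fun t => realSymbol (W t) (ω t) := by
  have h1 : Continuous fun t => toBoundedContinuousFunctionCLM ℝ V ℂ (𝓕⁻ (W t)) :=
    (toBoundedContinuousFunctionCLM ℝ V ℂ).continuous.comp
      ((fourierInvCLM ℝ 𝓢(V, ℂ)).continuous.comp hW)
  have h2 : Continuous fun t => 𝓕⁻ (W t) (ω t) := continuous_eval.comp (h1.prodMk hω)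
  exact continuous_const.mul (Complex.continuous_re.comp h2)

lemma exists_norm_realSymbol_innovation_le (γ b ε : 𝓢(V, ℂ)) (L N : ℕ) :
    ∃ C : ℝ, 0 < C ∧ ∀ x x' ω : V,
      ‖realSymbol (schwartzMul (innovation ε (compSubConstCLM ℝ x b)) (compSubConstCLM ℝ x' γ)) ω‖ *
        ((1 + ‖x' - x‖) ^ L * (1 + ‖ω‖) ^ N) ≤ C := by
  obtain ⟨M, C, hC, h⟩ := exists_realSymbol_le (V := V) N
  let Q := fun φ : 𝓢(V, ℂ) => 2 ^ (M + L) * schwartzNorm V (M + L) φ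
  set Q' := 2 ^ (M + L) * (2 ^ (M + L + L) * schwartzNorm V (M + L + L) ε) *
        (2 ^ (M + L + L) * schwartzNorm V (M + L + L) (involution V b))
  let C₁ := 2 ^ M * Q b * Q γ
  let C₂ := 2 ^ M * (2 ^ (M + L) * Q') * Q γ
  have hC₁ : 0 ≤ C₁ := by positivity
  have hC₂ : 0 ≤ C₂ := by positivity
  refine ⟨C * C₁ + C * C₂ + 1, by positivity, fun x x' ω => ?_⟩
  set W₁ := schwartzMul b (compSubConstCLM ℝ (x' - x) γ)
  set E := schwartzMul ε (compSubConstCLM ℝ (-x) (involution V b))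
  set W₂ := schwartzMul E (compSubConstCLM ℝ x' γ)
  have hW : realSymbol (schwartzMul (innovation ε (compSubConstCLM ℝ x b))
      (compSubConstCLM ℝ x' γ)) ω = realSymbol (compSubConstCLM ℝ x W₁) ω -
        realSymbol (compSubConstCLM ℝ 0 W₂) ω := by
    have : schwartzMul (innovation ε (compSubConstCLM ℝ x b)) (compSubConstCLM ℝ x' γ) =
        compSubConstCLM ℝ x W₁ - compSubConstCLM ℝ 0 W₂ := by
      ext y
      simp [innovation, W₁, W₂, E, involution_compSubConst]
    rw [this]
    exact realSymbol_sub _ _ _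
  have h1 : (1 + ‖x' - x‖) ^ L * schwartzNorm V M W₁ ≤ C₁ :=
    schwartzNorm_mul_compSubConst_le M L (x' - x) b γ
  have hE : (1 + ‖x‖) ^ L * schwartzNorm V (M + L) E ≤ Q' := by
    simpa using schwartzNorm_mul_compSubConst_le (M + L) L (-x) ε (involution V b)
  have h2 : (1 + ‖x' - x‖) ^ L * schwartzNorm V M W₂ ≤ C₂ := by
    have hx : 1 + ‖x' - x‖ ≤ (1 + ‖x‖) * (1 + ‖x'‖) := by
      nlinarith [norm_sub_le x' x, norm_nonneg x, norm_nonneg x']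
    calc _ ≤ ((1 + ‖x‖) * (1 + ‖x'‖)) ^ L * schwartzNorm V M W₂ := by gcongr
      _ = (1 + ‖x‖) ^ L * ((1 + ‖x'‖) ^ L * schwartzNorm V M W₂) := by rw [mul_pow]; ring
      _ ≤ (1 + ‖x‖) ^ L * (2 ^ M * (2 ^ (M + L) * schwartzNorm V (M + L) E) * Q γ) :=
        mul_le_mul_of_nonneg_left (schwartzNorm_mul_compSubConst_le M L x' E γ) (by positivity)
      _ = 2 ^ M * (2 ^ (M + L) * ((1 + ‖x‖) ^ L * schwartzNorm V (M + L) E)) * Q γ := by ring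
      _ ≤ C₂ := by
        refine mul_le_mul_of_nonneg_right (mul_le_mul_of_nonneg_left
          (mul_le_mul_of_nonneg_left hE (by positivity)) (by positivity)) (by positivity)
  rw [hW]
  calc _ ≤ (‖realSymbol (compSubConstCLM ℝ x W₁) ω‖ + ‖realSymbol (compSubConstCLM ℝ 0 W₂) ω‖) *
        ((1 + ‖x' - x‖) ^ L * (1 + ‖ω‖) ^ N) := by
        gcongr
        exact norm_sub_le _ _
    _ = (1 + ‖x' - x‖) ^ L * ((1 + ‖ω‖) ^ N * ‖realSymbol (compSubConstCLM ℝ x W₁) ω‖) +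
        (1 + ‖x' - x‖) ^ L * ((1 + ‖ω‖) ^ N * ‖realSymbol (compSubConstCLM ℝ 0 W₂) ω‖) := by ring
    _ ≤ (1 + ‖x' - x‖) ^ L * (C * schwartzNorm V M W₁) +
        (1 + ‖x' - x‖) ^ L * (C * schwartzNorm V M W₂) :=
      add_le_add (mul_le_mul_of_nonneg_left (h W₁ x ω) (by positivity))
        (mul_le_mul_of_nonneg_left (h W₂ 0 ω) (by positivity))
    _ = C * ((1 + ‖x' - x‖) ^ L * schwartzNorm V M W₁) +
        C * ((1 + ‖x' - x‖) ^ L * schwartzNorm V M W₂) := by ring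
    _ ≤ C * C₁ + C * C₂ := add_le_add (mul_le_mul_of_nonneg_left h1 hC.le)
        (mul_le_mul_of_nonneg_left h2 hC.le)
    _ ≤ _ := by linarith

end Reproducing

section LocalBound

open SchwartzMap FourierTransform RealInnerProductSpace ComplexConjugate Module

variable {V : Type*} [NormedAddCommGroup V]

/-- The weight `(1 + ‖z‖)⁻¹`. -/
def decayWeight (z : V) : ℝ≥0∞ := ENNReal.ofReal ((1 + ‖z‖)⁻¹)

lemma decay_eq_inv (z : V) : decayWeight z = (ENNReal.ofReal (1 + ‖z‖))⁻¹ :=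
  ENNReal.ofReal_inv_of_pos (by positivity)

lemma decay_zero : decayWeight (0 : V) = 1 := by simp [decayWeight]

lemma decay_neg (z : V) : decayWeight (-z) = decayWeight z := by simp [decayWeight]

lemma decay_ne_top (z : V) : decayWeight z ≠ ∞ := ENNReal.ofReal_ne_top

lemma decay_ne_zero (z : V) : decayWeight z ≠ 0 := by
  rw [decay_eq_inv]
  exact ENNReal.inv_ne_zero.2 ENNReal.ofReal_ne_top

lemma decay_le_one (z : V) : decayWeight z ≤ 1 :=
  ENNReal.ofReal_le_one.2 (inv_le_one_of_one_le₀ (by linarith [norm_nonneg z]))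

lemma decay_mul_decay_le (x y : V) : decayWeight x * decayWeight y ≤ decayWeight (x + y) := by
  rw [decayWeight, decayWeight, ← ENNReal.ofReal_mul (by positivity), ← mul_inv]
  refine ENNReal.ofReal_le_ofReal (inv_anti₀ (by positivity) ?_)
  nlinarith [norm_add_le x y, norm_nonneg x, norm_nonneg y]

lemma ofReal_pow_mul_decay_pow (z : V) (n : ℕ) :
    ENNReal.ofReal ((1 + ‖z‖) ^ n) * decayWeight z ^ n = 1 := by
  have h : 0 < 1 + ‖z‖ := by positivity
  rw [decayWeight, ← ENNReal.ofReal_pow (by positivity), ← ENNReal.ofReal_mul (by positivity), inv_pow,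
    mul_inv_cancel₀ (by positivity), ENNReal.ofReal_one]

lemma enorm_le_mul_decay {G : Type*} [SeminormedAddCommGroup G] {r : G} {C : ℝ} {z w : V}
    {L N : ℕ} (h : ‖r‖ * ((1 + ‖z‖) ^ L * (1 + ‖w‖) ^ N) ≤ C) :
    ‖r‖ₑ ≤ ENNReal.ofReal C * (decayWeight z ^ L * decayWeight w ^ N) := by
  have h1 := ENNReal.ofReal_le_ofReal h
  rw [ENNReal.ofReal_mul (norm_nonneg _), ENNReal.ofReal_mul (by positivity),
    ofReal_norm] at h1
  calc ‖r‖ₑ = ‖r‖ₑ * ((ENNReal.ofReal ((1 + ‖z‖) ^ L) * decayWeight z ^ L) *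
        (ENNReal.ofReal ((1 + ‖w‖) ^ N) * decayWeight w ^ N)) := by
        simp [ofReal_pow_mul_decay_pow]
    _ = ‖r‖ₑ * (ENNReal.ofReal ((1 + ‖z‖) ^ L) * ENNReal.ofReal ((1 + ‖w‖) ^ N)) *
        (decayWeight z ^ L * decayWeight w ^ N) := by ring
    _ ≤ _ := by gcongr

lemma measurable_decay [MeasurableSpace V] [OpensMeasurableSpace V] :
    Measurable (decayWeight : V → ℝ≥0∞) :=
  ((measurable_norm.const_add 1).inv).ennreal_ofReal

variable [InnerProductSpace ℝ V] [FiniteDimensional ℝ V] [MeasurableSpace V] [BorelSpace V]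

variable (V) in
lemma integrable_one_add_norm_inv_pow :
    Integrable fun z : V => ((1 + ‖z‖) ^ (finrank ℝ V + 1))⁻¹ := by
  refine (integrable_one_add_norm (E := V) (μ := volume) (r := finrank ℝ V + 1)
    (by simp)).congr (.of_forall fun z => ?_)
  simp only
  rw [Real.rpow_neg (by positivity)]
  norm_cast

variable (V) in
lemma lintegral_decay_pow_ne_top : ∫⁻ z : V, decayWeight z ^ (finrank ℝ V + 1) ≠ ∞ := by
  have h := (integrable_one_add_norm_inv_pow V).lintegral_lt_top
  refine ne_of_lt (lt_of_eq_of_lt (lintegral_congr fun z => ?_) h)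
  rw [decayWeight, ← ENNReal.ofReal_pow (by positivity), inv_pow]

lemma exists_schwartzNorm_smul_tfShift_le (b : 𝓢(V, ℂ)) (M : ℕ) : ∃ A : ℕ, ∃ C : ℝ, 0 < C ∧
    ∀ (k B : ℝ) (x ω : V),
      ‖k‖ * ((1 + ‖x‖) ^ (A + (finrank ℝ V + 1)) * (1 + ‖ω‖) ^ (A + (finrank ℝ V + 1))) ≤ B →
      schwartzNorm V M (k • tfShift b x ω) ≤
        C * B * (((1 + ‖x‖) ^ (finrank ℝ V + 1))⁻¹ * ((1 + ‖ω‖) ^ (finrank ℝ V + 1))⁻¹) := by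
  obtain ⟨A, C, hC, h⟩ := exists_schwartzNorm_tfShift_le b M
  refine ⟨A, C, hC, fun k B x ω hk => ?_⟩
  rw [map_smul_eq_mul]
  have hx : 0 < (1 + ‖x‖) ^ (finrank ℝ V + 1) := by positivity
  have hω : 0 < (1 + ‖ω‖) ^ (finrank ℝ V + 1) := by positivity
  rw [← mul_inv, ← div_eq_mul_inv, le_div_iff₀ (by positivity)]
  calc _ ≤ ‖k‖ * (C * ((1 + ‖x‖) ^ A * (1 + ‖ω‖) ^ A)) *
        ((1 + ‖x‖) ^ (finrank ℝ V + 1) * (1 + ‖ω‖) ^ (finrank ℝ V + 1)) := by gcongr; exact h x ω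
    _ = C * (‖k‖ * ((1 + ‖x‖) ^ (A + (finrank ℝ V + 1)) *
        (1 + ‖ω‖) ^ (A + (finrank ℝ V + 1)))) := by ring
    _ ≤ _ := by gcongr

lemma apply_eq_integral_tfShift {b h : 𝓢(V, ℂ)} {x : V} {k : V → ℝ} (hc : Continuous k)
    (hk : ∀ N, ∃ C, ∀ ω, ‖k ω‖ * (1 + ‖ω‖) ^ N ≤ C)
    (hh : ∀ y, h y = ∫ ω, (k ω • tfShift b x ω) y) (f : 𝓢(V, ℂ) →L[ℝ] ℝ) :
    f h = ∫ ω, k ω * f (tfShift b x ω) := by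
  have hT : Continuous fun ω => tfShift b x ω :=
    Continuous.modulation continuous_id' continuous_const
  have hF : Continuous fun ω => k ω • tfShift b x ω := hc.smul hT
  refine (f.apply_eq_integral_of_schwartz hF (fun M => ?_) hh).trans
    (integral_congr_ae (.of_forall fun ω => by simp))
  obtain ⟨A, C, hC, hM⟩ := exists_schwartzNorm_smul_tfShift_le b M
  obtain ⟨B, hB⟩ := hk (A + (finrank ℝ V + 1))
  refine ((integrable_one_add_norm_inv_pow V).const_mul
    (C * ((1 + ‖x‖) ^ (A + (finrank ℝ V + 1)) * B) *
      ((1 + ‖x‖) ^ (finrank ℝ V + 1))⁻¹)).mono'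
    ((continuous_schwartzNorm M).comp hF).aestronglyMeasurable (.of_forall fun ω => ?_)
  rw [Real.norm_of_nonneg (apply_nonneg _ _), mul_assoc _ (_⁻¹) (_⁻¹)]
  refine hM _ _ _ _ ?_
  calc _ = (1 + ‖x‖) ^ (A + (finrank ℝ V + 1)) *
        (‖k ω‖ * (1 + ‖ω‖) ^ (A + (finrank ℝ V + 1))) := by ring
    _ ≤ _ := by gcongr; exact hB ω

lemma apply_eq_integral_prod_tfShift {b h : 𝓢(V, ℂ)} {k : V × V → ℝ} (hc : Continuous k)
    (hk : ∀ N, ∃ C, ∀ p, ‖k p‖ * ((1 + ‖p.1‖) ^ N * (1 + ‖p.2‖) ^ N) ≤ C)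
    (hh : ∀ y, h y = ∫ x, ∫ ω, (k (x, ω) • tfShift b x ω) y) (f : 𝓢(V, ℂ) →L[ℝ] ℝ) :
    f h = ∫ p, k p * f (tfShift b p.1 p.2) := by
  have hF : Continuous fun p : V × V => k p • tfShift b p.1 p.2 :=
    hc.smul (continuous_tfShift b)
  have hint : ∀ M, Integrable fun p : V × V => schwartzNorm V M (k p • tfShift b p.1 p.2) :=
    fun M => by
      obtain ⟨A, C, hC, hM⟩ := exists_schwartzNorm_smul_tfShift_le b M
      obtain ⟨B, hB⟩ := hk (A + (finrank ℝ V + 1))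
      refine (((integrable_one_add_norm_inv_pow V).mul_prod
        (integrable_one_add_norm_inv_pow V)).const_mul (C * B)).mono'
        ((continuous_schwartzNorm M).comp hF).aestronglyMeasurable (.of_forall fun p => ?_)
      rw [Real.norm_of_nonneg (apply_nonneg _ _)]
      exact hM _ _ _ _ (hB p)
  refine (f.apply_eq_integral_of_schwartz hF hint fun y => ?_).trans
    (integral_congr_ae (.of_forall fun ω => by simp))
  have := integrable_of_schwartzNorm hF hint
    ((BoundedContinuousFunction.evalCLM ℝ y) ∘L toBoundedContinuousFunctionCLM ℝ V ℂ)
  rw [hh]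
  exact (integral_prod _ this).symm

/-- The value of a functional at a translated window is controlled by its values at the
time-frequency shifts along a fixed window. -/
theorem exists_enorm_apply_compSubConst_le {b : 𝓢(V, ℂ)} (hb : b ≠ 0) (L N : ℕ) :
    ∃ C : ℝ≥0∞, C ≠ ∞ ∧ ∀ (f : 𝓢(V, ℂ) →L[ℝ] ℝ) (x : V),
      ‖f (compSubConstCLM ℝ x b)‖ₑ ≤
        C * ∫⁻ ω, (⨆ x', ‖f (tfShift b x' ω)‖ₑ * decayWeight (x' - x) ^ L) * decayWeight ω ^ N := by
  obtain ⟨γ, hγ⟩ := exists_dualWindow hb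
  obtain ⟨ε, hε⟩ := exists_crossCorrelation γ b
  have hdec := exists_realSymbol_le (V := V)
  have hk₀ : ∀ n, ∃ C, ∀ ω : V,
      ‖realSymbol ((1 / 2 : ℝ) • localPart ε) ω‖ * (1 + ‖ω‖) ^ n ≤ C := fun n => by
    obtain ⟨M, C, -, h⟩ := hdec n
    refine ⟨C * schwartzNorm V M ((1 / 2 : ℝ) • localPart ε), fun ω => ?_⟩
    have := h ((1 / 2 : ℝ) • localPart ε) 0 ω
    rw [mul_comm]
    convert this
    ext; simp
  obtain ⟨C₀, hC₀⟩ := hk₀ N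
  obtain ⟨C₁, -, hC₁⟩ := exists_norm_realSymbol_innovation_le γ b ε (L + (finrank ℝ V + 1)) N
  set K := ∫⁻ z : V, decayWeight z ^ (finrank ℝ V + 1) with hK
  have hKtop : K ≠ ∞ := lintegral_decay_pow_ne_top V
  refine ⟨ENNReal.ofReal C₀ + ENNReal.ofReal C₁ * K, by
    simp [ENNReal.mul_eq_top, hKtop], fun f x => ?_⟩
  set S := fun ω => ⨆ x', ‖f (tfShift b x' ω)‖ₑ * decayWeight (x' - x) ^ L with hS
  set h := compSubConstCLM ℝ x b
  set k₀ := fun ω => realSymbol ((1 / 2 : ℝ) • localPart ε) ω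
  set k₁ := fun p : V × V =>
    realSymbol (schwartzMul (innovation ε h) (compSubConstCLM ℝ p.1 γ)) p.2 with hk₁
  have hk₀c : Continuous k₀ := continuous_const.realSymbol continuous_id
  have hk₁c : Continuous k₁ := by
    refine Continuous.realSymbol ?_ continuous_snd
    exact ((SchwartzMap.pairing (ContinuousLinearMap.mul ℝ ℂ)) (innovation ε h)).continuous.comp
      (continuous_fst.compSubConst continuous_const)
  have hk₁d : ∀ n, ∃ C, ∀ p : V × V, ‖k₁ p‖ * ((1 + ‖p.1‖) ^ n * (1 + ‖p.2‖) ^ n) ≤ C :=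
    fun n => by
      obtain ⟨C, -, hC⟩ := exists_norm_realSymbol_innovation_le γ b ε n n
      refine ⟨(1 + ‖x‖) ^ n * C, fun p => ?_⟩
      have hp : 1 + ‖p.1‖ ≤ (1 + ‖x‖) * (1 + ‖p.1 - x‖) := by
        nlinarith [norm_le_norm_add_norm_sub' p.1 x, norm_nonneg x, norm_nonneg (p.1 - x)]
      calc _ ≤ ‖k₁ p‖ * (((1 + ‖x‖) * (1 + ‖p.1 - x‖)) ^ n * (1 + ‖p.2‖) ^ n) := by gcongr
        _ = (1 + ‖x‖) ^ n * (‖k₁ p‖ * ((1 + ‖p.1 - x‖) ^ n * (1 + ‖p.2‖) ^ n)) := by rw [mul_pow]; ring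
        _ ≤ _ := mul_le_mul_of_nonneg_left (hC x p.1 p.2) (by positivity)
  have h₀ := apply_eq_integral_tfShift hk₀c hk₀ (integral_localPart_tfShift ε b x) f
  have h₁ := apply_eq_integral_prod_tfShift hk₁c hk₁d (integral_innovation_tfShift hγ hε h) f
  have hle : ∀ x' ω, ‖f (tfShift b x' ω)‖ₑ * decayWeight (x' - x) ^ L ≤ S ω := fun x' ω =>
    le_iSup (fun x' => ‖f (tfShift b x' ω)‖ₑ * decayWeight (x' - x) ^ L) x'
  have b₀ : ‖f (schwartzMul (localPart ε) h)‖ₑ ≤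
      ENNReal.ofReal C₀ * ∫⁻ ω, S ω * decayWeight ω ^ N := by
    rw [h₀, ← lintegral_const_mul' _ _ ENNReal.ofReal_ne_top]
    refine (enorm_integral_le_lintegral_enorm _).trans (lintegral_mono fun ω => ?_)
    rw [enorm_mul]
    have e1 : ‖k₀ ω‖ₑ ≤ ENNReal.ofReal C₀ * (decayWeight (0 : V) ^ 0 * decayWeight ω ^ N) :=
      enorm_le_mul_decay (by simpa only [pow_zero, one_mul] using hC₀ ω)
    have e2 := hle x ω
    rw [sub_self, decay_zero, one_pow, mul_one] at e2
    calc _ ≤ ENNReal.ofReal C₀ * (decayWeight (0 : V) ^ 0 * decayWeight ω ^ N) * S ω := by gcongr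
      _ = _ := by rw [pow_zero]; ring
  have b₁ : ‖f (h - schwartzMul (localPart ε) h)‖ₑ ≤
      ENNReal.ofReal C₁ * K * ∫⁻ ω, S ω * decayWeight ω ^ N := by
    have hmeas : Measurable fun p : V × V => ‖k₁ p * f (tfShift b p.1 p.2)‖ₑ :=
      (hk₁c.mul (f.continuous.comp (continuous_tfShift b))).enorm.measurable
    rw [h₁, ← lintegral_const_mul' _ _
      (ENNReal.mul_ne_top ENNReal.ofReal_ne_top hKtop)]
    refine (enorm_integral_le_lintegral_enorm _).trans ?_
    rw [Measure.volume_eq_prod, lintegral_prod_symm _ hmeas.aemeasurable]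
    refine lintegral_mono fun ω => ?_
    calc _ ≤ ∫⁻ x', decayWeight (x' - x) ^ (finrank ℝ V + 1) *
          (ENNReal.ofReal C₁ * (S ω * decayWeight ω ^ N)) := lintegral_mono fun x' => ?_
      _ = _ := by
        have hm : Measurable fun x' : V => decayWeight (x' - x) ^ (finrank ℝ V + 1) :=
          (measurable_decay.comp (measurable_sub_const x)).pow_const _
        rw [lintegral_mul_const _ hm,
          lintegral_sub_right_eq_self (fun z => decayWeight z ^ (finrank ℝ V + 1)) x, ← hK]
        ring
    rw [enorm_mul]
    have e1 : ‖k₁ (x', ω)‖ₑ ≤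
        ENNReal.ofReal C₁ * (decayWeight (x' - x) ^ (L + (finrank ℝ V + 1)) * decayWeight ω ^ N) :=
      enorm_le_mul_decay (hC₁ x x' ω)
    calc _ ≤ ENNReal.ofReal C₁ * (decayWeight (x' - x) ^ (L + (finrank ℝ V + 1)) * decayWeight ω ^ N) *
          ‖f (tfShift b x' ω)‖ₑ := by gcongr
      _ = decayWeight (x' - x) ^ (finrank ℝ V + 1) * (ENNReal.ofReal C₁ *
          (‖f (tfShift b x' ω)‖ₑ * decayWeight (x' - x) ^ L * decayWeight ω ^ N)) := by ring
      _ ≤ _ := by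
        gcongr
        exact hle x' ω
  calc ‖f h‖ₑ = ‖f (schwartzMul (localPart ε) h) + f (h - schwartzMul (localPart ε) h)‖ₑ := by
        rw [← map_add, add_sub_cancel]
    _ ≤ _ := (enorm_add_le _ _).trans ((add_le_add b₀ b₁).trans_eq (add_mul _ _ _).symm)

/-- The uniform local estimate for the short-time Fourier transform of a complex valued
real-linear functional. -/
theorem exists_enorm_apply_tfShift_le {b : 𝓢(V, ℂ)} (hb : b ≠ 0) (L N : ℕ) :
    ∃ C : ℝ≥0∞, C ≠ ∞ ∧ ∀ (f : 𝓢(V, ℂ) →L[ℝ] ℂ) (x ω₀ : V),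
      ‖f (tfShift b x ω₀)‖ₑ ≤
        C * ∫⁻ ω, (⨆ x', ‖f (tfShift b x' ω)‖ₑ * decayWeight (x' - x) ^ L) * decayWeight (ω - ω₀) ^ N := by
  obtain ⟨C, hC, h⟩ := exists_enorm_apply_compSubConst_le hb L N
  refine ⟨C, hC, fun f x ω₀ => ?_⟩
  obtain ⟨c, hc, hcf⟩ : ∃ c : ℂ, ‖c‖ = 1 ∧ ‖f (tfShift b x ω₀)‖ = c * f (tfShift b x ω₀) :=
    RCLike.exists_norm_eq_mul_self _
  let f' : 𝓢(V, ℂ) →L[ℝ] ℝ :=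
    Complex.reCLM ∘L (ContinuousLinearMap.mul ℝ ℂ c) ∘L f ∘L modulation ω₀
  have hf' : ∀ φ, ‖f' φ‖ₑ ≤ ‖f (modulation ω₀ φ)‖ₑ := fun φ => by
    rw [enorm_le_iff_norm_le]
    refine (Complex.abs_re_le_norm _).trans_eq ?_
    simp [hc]
  have h0 : ‖f (tfShift b x ω₀)‖ₑ = ‖f' (compSubConstCLM ℝ x b)‖ₑ := by
    have : f' (compSubConstCLM ℝ x b) = ‖f (tfShift b x ω₀)‖ := by
      change (c * f (tfShift b x ω₀)).re = _
      rw [← hcf, Complex.ofReal_re]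
    rw [this, enorm_norm]
  rw [h0]
  refine (h f' x).trans (mul_le_mul_right ?_ C)
  rw [← lintegral_sub_right_eq_self _ ω₀]
  refine lintegral_mono fun ω => ?_
  gcongr with x'
  refine (hf' _).trans_eq ?_
  rw [modulation_tfShift, sub_add_cancel]

end LocalBound

section Amalgam

variable {α : Type*} [MeasurableSpace α] {μ : Measure α}

/-- A Hölder inequality with a non-optimal constant which needs no measurability of the first
factor. -/
lemma lintegral_mul_le_rpow_mul_one_add {p p' : ℝ} (hp : p.HolderConjugate p') (S : α → ℝ≥0∞)
    {D : α → ℝ≥0∞} (hD : Measurable D)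
    (hDi : ∫⁻ t, D t ^ p' ∂μ ≠ ∞) :
    ∫⁻ t, S t * D t ∂μ ≤ (∫⁻ t, S t ^ p ∂μ) ^ (1 / p) * (1 + ∫⁻ t, D t ^ p' ∂μ) := by
  have hp0 : 0 < p := hp.pos
  set J₀ := (∫⁻ t, S t ^ p ∂μ) ^ (1 / p)
  have key : ∀ J, J₀ < J → J ≠ ∞ → ∫⁻ t, S t * D t ∂μ ≤ J * (1 + ∫⁻ t, D t ^ p' ∂μ) := by
    intro J hJ hJt
    have hJ0 : J ≠ 0 := (bot_le.trans_lt hJ).ne'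
    have hone : ∀ x : ℝ≥0∞, ∀ c : ℝ, 1 ≤ c → x / ENNReal.ofReal c ≤ x := fun x c hc =>
      ENNReal.div_le_of_le_mul (le_mul_of_one_le_right bot_le (ENNReal.one_le_ofReal.2 hc))
    have hpt : ∀ t, S t * D t ≤ J * (J⁻¹ ^ p * S t ^ p + D t ^ p') := fun t => by
      calc S t * D t = J * ((J⁻¹ * S t) * D t) := by
            rw [← mul_assoc, ← mul_assoc, ENNReal.mul_inv_cancel hJ0 hJt, one_mul]
        _ ≤ J * ((J⁻¹ * S t) ^ p / ENNReal.ofReal p + D t ^ p' / ENNReal.ofReal p') := by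
            gcongr
            exact ENNReal.young_inequality _ _ hp
        _ ≤ J * ((J⁻¹ * S t) ^ p + D t ^ p') := by
            gcongr
            · exact hone _ _ hp.lt.le
            · exact hone _ _ hp.symm.lt.le
        _ = _ := by rw [ENNReal.mul_rpow_of_nonneg _ _ hp0.le]
    refine (lintegral_mono hpt).trans ?_
    rw [lintegral_const_mul' _ _ hJt, lintegral_add_right _ (hD.pow_const _),
      lintegral_const_mul' _ _ (ENNReal.rpow_ne_top_of_nonneg hp0.le (ENNReal.inv_ne_top.2 hJ0))]
    gcongr
    have : ∫⁻ t, S t ^ p ∂μ ≤ J ^ p := by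
      have := ENNReal.rpow_le_rpow hJ.le hp0.le
      rwa [← ENNReal.rpow_mul, one_div_mul_cancel hp0.ne', ENNReal.rpow_one] at this
    calc _ ≤ J⁻¹ ^ p * J ^ p := by gcongr
      _ = 1 := by
        rw [← ENNReal.mul_rpow_of_nonneg _ _ hp0.le, ENNReal.inv_mul_cancel hJ0 hJt,
          ENNReal.one_rpow]
  rw [← ENNReal.div_le_iff (by simp) (by simp [hDi])]
  refine le_of_forall_gt_imp_ge_of_dense fun J hJ => ?_
  rcases eq_or_ne J ∞ with rfl | hJt
  · exact le_top
  · exact ENNReal.div_le_of_le_mul (key J hJ hJt)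

end Amalgam

section UniformBound

open Module

variable {V : Type*} [NormedAddCommGroup V] [MeasurableSpace V] {μ : Measure V}

/-- `U` is controlled by its local averages with constants `C L N`. -/
def IsLocallyControlled (μ : Measure V) (C : ℕ → ℕ → ℝ≥0∞) (U : V → V → ℝ≥0∞) : Prop :=
  ∀ L N x ω₀, U x ω₀ ≤
    C L N * ∫⁻ ω, (⨆ x', U x' ω * decayWeight (x' - x) ^ L) * decayWeight (ω - ω₀) ^ N ∂μ

lemma IsLocallyControlled.mul_weight {C : ℕ → ℕ → ℝ≥0∞} {U : V → V → ℝ≥0∞}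
    (hU : IsLocallyControlled μ C U) {a w : V → ℝ≥0∞} {K K' : ℕ}
    (ha : ∀ x x', a x * decayWeight (x' - x) ^ K ≤ a x')
    (hw : ∀ x x', w x * decayWeight (x' - x) ^ K' ≤ w x') (hat : ∀ x, a x ≠ ∞)
    (hwt : ∀ x, w x ≠ ∞) :
    IsLocallyControlled μ (fun L N => C (L + K) (N + K')) fun x ω => U x ω * a x * w ω := by
  intro L N x ω₀
  calc U x ω₀ * a x * w ω₀ ≤ C (L + K) (N + K') * (∫⁻ ω, (⨆ x', U x' ω *
        decayWeight (x' - x) ^ (L + K)) * decayWeight (ω - ω₀) ^ (N + K') ∂μ) * a x * w ω₀ := by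
        gcongr
        exact hU _ _ _ _
    _ = C (L + K) (N + K') * ∫⁻ ω, (⨆ x', U x' ω *
        decayWeight (x' - x) ^ (L + K)) * decayWeight (ω - ω₀) ^ (N + K') * (a x * w ω₀) ∂μ := by
        rw [lintegral_mul_const' _ _ (ENNReal.mul_ne_top (hat x) (hwt ω₀))]
        ring
    _ ≤ _ := ?_
  refine mul_le_mul_right (lintegral_mono fun ω => ?_) _
  simp only [ENNReal.iSup_mul]
  refine iSup_mono fun x' => ?_
  calc _ = U x' ω * decayWeight (x' - x) ^ L * decayWeight (ω - ω₀) ^ N *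
        (a x * decayWeight (x' - x) ^ K) * (w ω₀ * decayWeight (ω - ω₀) ^ K') := by ring
    _ ≤ U x' ω * decayWeight (x' - x) ^ L * decayWeight (ω - ω₀) ^ N * a x' * w ω := by
        gcongr
        · exact ha _ _
        · exact hw _ _
    _ = _ := by ring

variable {C : ℕ → ℕ → ℝ≥0∞} {U : V → V → ℝ≥0∞}

lemma IsLocallyControlled.le_rpow_of_iSup_ne_top (hU : IsLocallyControlled μ C U) {q : ℝ}
    (hq : 0 < q) (hq1 : q ≤ 1) (L N : ℕ) (x ω₀ : V)
    (hG : ⨆ x', ⨆ ω, U x' ω * decayWeight (x' - x) ^ L * decayWeight (ω - ω₀) ^ N ≠ ∞) :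
    U x ω₀ ≤ (C L N * ∫⁻ ω, (⨆ x', U x' ω) ^ q ∂μ) ^ (1 / q) := by
  set G := ⨆ x', ⨆ ω, U x' ω * decayWeight (x' - x) ^ L * decayWeight (ω - ω₀) ^ N with hGdef
  set H := fun ω => (⨆ x', U x' ω * decayWeight (x' - x) ^ L) * decayWeight (ω - ω₀) ^ N with hH
  have hleG : ∀ x' ω, U x' ω * decayWeight (x' - x) ^ L * decayWeight (ω - ω₀) ^ N ≤ G :=
    fun x' ω => le_iSup₂ (f := fun x' ω =>
      U x' ω * decayWeight (x' - x) ^ L * decayWeight (ω - ω₀) ^ N) x' ω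
  have hHG : ∀ ω, H ω ≤ G := fun ω => by
    rw [hH]
    simp only [ENNReal.iSup_mul]
    exact iSup_le fun x' => hleG x' ω
  have hUG : U x ω₀ ≤ G := by simpa [decay_zero] using hleG x ω₀
  have hGH : G ≤ C L N * ∫⁻ ω, H ω ∂μ := by
    refine iSup₂_le fun x₁ ω₁ => ?_
    calc _ ≤ C L N * (∫⁻ ω, (⨆ x', U x' ω * decayWeight (x' - x₁) ^ L) *
          decayWeight (ω - ω₁) ^ N ∂μ) * decayWeight (x₁ - x) ^ L * decayWeight (ω₁ - ω₀) ^ N := by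
          gcongr
          exact hU _ _ _ _
      _ = C L N * ∫⁻ ω, (⨆ x', U x' ω * decayWeight (x' - x₁) ^ L) *
          decayWeight (ω - ω₁) ^ N * (decayWeight (x₁ - x) ^ L * decayWeight (ω₁ - ω₀) ^ N) ∂μ := by
          rw [lintegral_mul_const' _ _ (ENNReal.mul_ne_top (ENNReal.pow_ne_top (decay_ne_top _))
            (ENNReal.pow_ne_top (decay_ne_top _)))]
          ring
      _ ≤ _ := ?_
    refine mul_le_mul_right (lintegral_mono fun ω => ?_) _
    simp only [hH, ENNReal.iSup_mul]
    refine iSup_mono fun x' => ?_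
    calc _ = U x' ω * (decayWeight (x' - x₁) * decayWeight (x₁ - x)) ^ L *
          (decayWeight (ω - ω₁) * decayWeight (ω₁ - ω₀)) ^ N := by ring
      _ ≤ U x' ω * (decayWeight (x' - x₁ + (x₁ - x))) ^ L *
          (decayWeight (ω - ω₁ + (ω₁ - ω₀))) ^ N := by gcongr <;> exact decay_mul_decay_le _ _
      _ = _ := by rw [sub_add_sub_cancel, sub_add_sub_cancel]
  have hGq : G ^ (1 - q) ≠ ∞ := ENNReal.rpow_ne_top_of_nonneg (by linarith) hG
  have hsplit : ∀ y ≤ G, y ≤ G ^ (1 - q) * y ^ q := fun y hy => by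
    rcases eq_or_ne y 0 with rfl | hy0
    · exact bot_le
    calc y = y ^ (1 - q) * y ^ q := by
          rw [← ENNReal.rpow_add _ _ hy0 (ne_top_of_le_ne_top hG hy), sub_add_cancel,
            ENNReal.rpow_one]
      _ ≤ _ := by gcongr
  have hI : G ≤ G ^ (1 - q) * (C L N * ∫⁻ ω, (⨆ x', U x' ω) ^ q ∂μ) := by
    calc G ≤ C L N * ∫⁻ ω, H ω ∂μ := hGH
      _ ≤ C L N * ∫⁻ ω, G ^ (1 - q) * (⨆ x', U x' ω) ^ q ∂μ := by
        gcongr with ω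
        refine (hsplit _ (hHG ω)).trans ?_
        gcongr
        calc H ω ≤ (⨆ x', U x' ω * 1) * 1 := by
              simp only [hH]
              gcongr
              · exact pow_le_one₀ bot_le (decay_le_one _)
              · exact pow_le_one₀ bot_le (decay_le_one _)
          _ = _ := by simp
      _ = _ := by rw [lintegral_const_mul' _ _ hGq]; ring
  refine hUG.trans ?_
  rcases eq_or_ne G 0 with h0 | h0
  · rw [h0]
    exact bot_le
  rw [← ENNReal.rpow_le_rpow_iff hq, ← ENNReal.rpow_mul, one_div_mul_cancel hq.ne',
    ENNReal.rpow_one]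
  have h1 : G ^ (1 - q) ≠ 0 := by simp [ENNReal.rpow_eq_zero_iff, h0, hG]
  rw [← ENNReal.mul_le_mul_iff_right h1 hGq, ← ENNReal.rpow_add _ _ h0 hG, sub_add_cancel,
    ENNReal.rpow_one]
  exact hI

/-- A locally controlled function of polynomial growth is bounded by its mixed quasi-norm with
exponent at most one. -/
theorem IsLocallyControlled.le_rpow_lintegral_of_le_one (hU : IsLocallyControlled μ C U)
    (hC : ∀ L N, C L N ≠ ∞) {A : ℕ} {B : ℝ≥0∞} (hB : B ≠ ∞)
    (hgrowth : ∀ x ω, U x ω * (decayWeight x ^ A * decayWeight ω ^ A) ≤ B) {q : ℝ}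
    (hq : 0 < q) (hq1 : q ≤ 1) (x ω₀ : V) :
    U x ω₀ ≤ C 0 0 ^ (1 / q) * (∫⁻ ω, (⨆ x', U x' ω) ^ q ∂μ) ^ (1 / q) := by
  rw [← ENNReal.mul_rpow_of_nonneg _ _ (by positivity)]
  set I := ∫⁻ ω, (⨆ x', U x' ω) ^ q ∂μ
  have hbdd : I ≠ ∞ → ⨆ x', ⨆ ω, U x' ω ≠ ∞ := fun hI => by
    refine ne_top_of_le_ne_top (b := (C A A * I) ^ (1 / q))
      (ENNReal.rpow_ne_top_of_nonneg (by positivity) (ENNReal.mul_ne_top (hC _ _) hI))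
      (iSup₂_le fun x ω₀ => hU.le_rpow_of_iSup_ne_top hq hq1 A A x ω₀ ?_)
    have hd : (decayWeight x ^ A * decayWeight ω₀ ^ A) ≠ 0 :=
      mul_ne_zero (pow_ne_zero _ (decay_ne_zero _)) (pow_ne_zero _ (decay_ne_zero _))
    have hd' : (decayWeight x ^ A * decayWeight ω₀ ^ A) ≠ ∞ :=
      ENNReal.mul_ne_top (ENNReal.pow_ne_top (decay_ne_top _))
        (ENNReal.pow_ne_top (decay_ne_top _))
    refine ne_top_of_le_ne_top (ENNReal.div_ne_top hB hd) (iSup₂_le fun x' ω => ?_)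
    rw [ENNReal.le_div_iff_mul_le (.inl hd) (.inl hd')]
    calc _ = U x' ω * ((decayWeight (x' - x) * decayWeight x) ^ A *
          (decayWeight (ω - ω₀) * decayWeight ω₀) ^ A) := by ring
      _ ≤ U x' ω * (decayWeight (x' - x + x) ^ A * decayWeight (ω - ω₀ + ω₀) ^ A) := by
        gcongr <;> exact decay_mul_decay_le _ _
      _ ≤ B := by simpa using hgrowth x' ω
  by_cases hI : I = ∞
  · by_cases h0 : C 0 0 = 0
    · refine (hU 0 0 x ω₀).trans ?_
      rw [h0, zero_mul]
      exact bot_le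
    · simp [hI, ENNReal.mul_top h0, hq]
  · exact hU.le_rpow_of_iSup_ne_top hq hq1 0 0 x ω₀ (by simpa using hbdd hI)

/-- The analogue of `IsLocallyControlled.le_rpow_lintegral_of_le_one` for exponents larger than
one. -/
theorem IsLocallyControlled.le_rpow_lintegral_of_one_lt [BorelSpace V] [μ.IsAddRightInvariant]
    (hU : IsLocallyControlled μ C U) {N : ℕ} (hN : ∫⁻ ω, decayWeight ω ^ N ∂μ ≠ ∞) {q : ℝ}
    (hq1 : 1 < q) (x ω₀ : V) :
    U x ω₀ ≤ C 0 N * (1 + ∫⁻ ω, decayWeight ω ^ N ∂μ) *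
      (∫⁻ ω, (⨆ x', U x' ω) ^ q ∂μ) ^ (1 / q) := by
  have hpq : q.HolderConjugate q.conjExponent := .conjExponent hq1
  have hm : Measurable fun ω : V => decayWeight (ω - ω₀) ^ N :=
    (measurable_decay.comp (measurable_sub_const ω₀)).pow_const _
  have hle : ∫⁻ ω, (decayWeight (ω - ω₀) ^ N) ^ q.conjExponent ∂μ ≤
      ∫⁻ ω, decayWeight ω ^ N ∂μ := by
    rw [← lintegral_sub_right_eq_self (fun ω => decayWeight ω ^ N) ω₀]
    refine lintegral_mono fun ω => ?_
    calc _ ≤ (decayWeight (ω - ω₀) ^ N) ^ (1 : ℝ) :=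
          ENNReal.rpow_le_rpow_of_exponent_ge (pow_le_one₀ bot_le (decay_le_one _))
            hpq.symm.lt.le
      _ = _ := ENNReal.rpow_one _
  refine (hU 0 N x ω₀).trans ?_
  rw [mul_assoc]
  gcongr
  simp only [pow_zero, mul_one]
  refine (lintegral_mul_le_rpow_mul_one_add hpq _ hm (ne_top_of_le_ne_top hN hle)).trans ?_
  rw [mul_comm]
  gcongr

end UniformBound

section Bracket

open Module

variable {V : Type*} [NormedAddCommGroup V]

/-- The weight `⟨x⟩ ^ m`, with values in `ℝ≥0∞`. -/
def bracketWeight (m : ℝ) (x : V) : ℝ≥0∞ := ENNReal.ofReal (√(1 + ‖x‖ ^ 2) ^ m)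

lemma one_le_sqrt_one_add_norm_sq (x : V) : 1 ≤ √(1 + ‖x‖ ^ 2) :=
  Real.one_le_sqrt.2 (by nlinarith [sq_nonneg ‖x‖])

lemma sqrt_one_add_norm_sq_le_mul (x x' : V) :
    √(1 + ‖x‖ ^ 2) ≤ √(1 + ‖x'‖ ^ 2) * (1 + ‖x' - x‖) := by
  rw [Real.sqrt_le_left (by positivity), mul_pow, Real.sq_sqrt (by positivity)]
  have h : ‖x‖ ≤ ‖x'‖ + ‖x' - x‖ := by
    have := norm_sub_le x' (x' - x)
    rwa [sub_sub_cancel] at this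
  nlinarith [norm_nonneg x, norm_nonneg x', norm_nonneg (x' - x),
    mul_nonneg (norm_nonneg (x' - x)) (sq_nonneg (‖x'‖ - 1)),
    mul_nonneg (norm_nonneg (x' - x)) (sq_nonneg ‖x'‖), sq_nonneg (‖x'‖ * ‖x' - x‖),
    pow_le_pow_left₀ (norm_nonneg x) h 2]

lemma bracketWeight_ne_top (m : ℝ) (x : V) : bracketWeight m x ≠ ∞ := ENNReal.ofReal_ne_top

lemma bracketWeight_add (m n : ℝ) (x : V) :
    bracketWeight (m + n) x = bracketWeight m x * bracketWeight n x := by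
  have h := one_le_sqrt_one_add_norm_sq x
  rw [bracketWeight, Real.rpow_add (by linarith), ENNReal.ofReal_mul (by positivity)]
  rfl

lemma bracketWeight_mono {m n : ℝ} (h : m ≤ n) (x : V) : bracketWeight m x ≤ bracketWeight n x :=
  ENNReal.ofReal_le_ofReal (Real.rpow_le_rpow_of_exponent_le (one_le_sqrt_one_add_norm_sq x) h)

lemma bracketWeight_rpow {m p : ℝ} (hp : 0 ≤ p) (x : V) :
    bracketWeight m x ^ p = bracketWeight (m * p) x := by
  rw [bracketWeight, ENNReal.ofReal_rpow_of_nonneg (by positivity) hp,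
    ← Real.rpow_mul (by positivity)]
  rfl

lemma exists_bracketWeight_mul_decay_le (m : ℝ) :
    ∃ K : ℕ, ∀ x x' : V, bracketWeight m x * decayWeight (x' - x) ^ K ≤ bracketWeight m x' := by
  obtain ⟨K, hK⟩ := exists_nat_ge |m|
  refine ⟨K, fun x x' => ?_⟩
  set t := 1 + ‖x' - x‖ with ht
  have ht1 : 1 ≤ t := by simp [ht]
  have hx := one_le_sqrt_one_add_norm_sq x
  have hx' := one_le_sqrt_one_add_norm_sq x'
  have key : √(1 + ‖x‖ ^ 2) ^ m ≤ √(1 + ‖x'‖ ^ 2) ^ m * t ^ K := by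
    have h1 : √(1 + ‖x‖ ^ 2) ^ m ≤ √(1 + ‖x'‖ ^ 2) ^ m * t ^ |m| := by
      rcases le_total 0 m with hm | hm
      · rw [abs_of_nonneg hm, ← Real.mul_rpow (by positivity) (by positivity)]
        exact Real.rpow_le_rpow (by positivity) (sqrt_one_add_norm_sq_le_mul x x') hm
      · have h2 := Real.rpow_le_rpow_of_nonpos (by positivity) (sqrt_one_add_norm_sq_le_mul x' x) hm
        rw [norm_sub_rev, Real.mul_rpow (by positivity) (by positivity), ← ht] at h2
        rw [abs_of_nonpos hm, Real.rpow_neg (by positivity), ← div_eq_mul_inv,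
          le_div_iff₀ (by positivity)]
        exact h2
    refine h1.trans (mul_le_mul_of_nonneg_left ?_ (by positivity))
    rw [← Real.rpow_natCast]
    exact Real.rpow_le_rpow_of_exponent_le ht1 hK
  calc _ ≤ ENNReal.ofReal (√(1 + ‖x'‖ ^ 2) ^ m * t ^ K) * decayWeight (x' - x) ^ K := by
        gcongr
        exact ENNReal.ofReal_le_ofReal key
    _ = bracketWeight m x' * (ENNReal.ofReal (t ^ K) * decayWeight (x' - x) ^ K) := by
        rw [ENNReal.ofReal_mul (by positivity), mul_assoc]
        rfl
    _ = _ := by rw [ht, ofReal_pow_mul_decay_pow, mul_one]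

variable [MeasurableSpace V] [BorelSpace V]

lemma measurable_bracketWeight (m : ℝ) : Measurable (bracketWeight m : V → ℝ≥0∞) :=
  (((measurable_norm.pow_const 2).const_add 1).sqrt.pow_const m).ennreal_ofReal

lemma lintegral_bracketWeight_ne_top [NormedSpace ℝ V] [FiniteDimensional ℝ V] {μ : Measure V}
    [μ.IsAddHaarMeasure] {a : ℝ} (ha : finrank ℝ V < a) : ∫⁻ x, bracketWeight (-a) x ∂μ ≠ ∞ := by
  have h := (integrable_rpow_neg_one_add_norm_sq (μ := μ) ha).lintegral_lt_top
  refine ne_of_lt (lt_of_eq_of_lt (lintegral_congr fun z => ?_) h)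
  rw [bracketWeight, Real.sqrt_eq_rpow, ← Real.rpow_mul (by positivity)]
  ring_nf

end Bracket

section MixedSize

open Module

variable {α : Type*} [MeasurableSpace α]

/-- The `L^q` (quasi-)norm of an `ℝ≥0∞`-valued function, with a true supremum for `q = ∞`. -/
def supLpSize (q : ℝ≥0∞) (μ : Measure α) (W : α → ℝ≥0∞) : ℝ≥0∞ :=
  if q = ∞ then ⨆ t, W t else (∫⁻ t, W t ^ q.toReal ∂μ) ^ (1 / q.toReal)

variable {μ : Measure α}

lemma supLpSize_mono {q : ℝ≥0∞} {W W' : α → ℝ≥0∞} (h : ∀ t, W t ≤ W' t) :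
    supLpSize q μ W ≤ supLpSize q μ W' := by
  unfold supLpSize
  split_ifs
  · exact iSup_mono h
  · gcongr with t
    exact h t

lemma supLpSize_le_of_le {q₁ q₂ : ℝ≥0∞} (hq₁ : q₁ ≠ 0) (h12 : q₁ ≤ q₂) {W : α → ℝ≥0∞}
    {C : ℝ≥0∞} (hC : 1 ≤ C) (hW : ∀ t, W t ≤ C * supLpSize q₁ μ W) :
    supLpSize q₂ μ W ≤ C * supLpSize q₁ μ W := by
  by_cases h2 : q₂ = ∞
  · rw [supLpSize, if_pos h2]
    exact iSup_le hW
  have h1 : q₁ ≠ ∞ := ne_top_of_le_ne_top h2 h12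
  have hp1 : 0 < q₁.toReal := ENNReal.toReal_pos hq₁ h1
  have hp12 : q₁.toReal ≤ q₂.toReal := ENNReal.toReal_mono h2 h12
  have hp2 := hp1.trans_le hp12
  set J := supLpSize q₁ μ W with hJ
  by_cases hCJ : C * J = ∞
  · rw [hCJ]
    exact le_top
  have hJ' : ∫⁻ t, W t ^ q₁.toReal ∂μ = J ^ q₁.toReal := by
    rw [hJ, supLpSize, if_neg h1, ← ENNReal.rpow_mul, one_div_mul_cancel hp1.ne', ENNReal.rpow_one]
  rw [supLpSize, if_neg h2, one_div, ENNReal.rpow_inv_le_iff hp2]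
  calc ∫⁻ t, W t ^ q₂.toReal ∂μ
      ≤ ∫⁻ t, (C * J) ^ (q₂.toReal - q₁.toReal) * W t ^ q₁.toReal ∂μ := lintegral_mono fun t => by
        calc W t ^ q₂.toReal = W t ^ (q₂.toReal - q₁.toReal) * W t ^ q₁.toReal := by
              rw [← ENNReal.rpow_add_of_nonneg _ _ (sub_nonneg.2 hp12) hp1.le, sub_add_cancel]
          _ ≤ _ := by
              gcongr
              exact hW t
    _ = (C * J) ^ (q₂.toReal - q₁.toReal) * J ^ q₁.toReal := by
        rw [lintegral_const_mul' _ _ (ENNReal.rpow_ne_top_of_nonneg (sub_nonneg.2 hp12) hCJ), hJ']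
    _ ≤ (C * J) ^ (q₂.toReal - q₁.toReal) * (C * J) ^ q₁.toReal := by
        gcongr
        exact le_mul_of_one_le_left bot_le hC
    _ = _ := by
        rw [← ENNReal.rpow_add_of_nonneg _ _ (sub_nonneg.2 hp12) hp1.le, sub_add_cancel]

/-- Raising the exponent `q₁` to `q₂` costs a polynomial weight of order more than
`d (1 / q₁ - 1 / q₂)`. -/
theorem exists_supLpSize_bracketWeight_le {V : Type*} [NormedAddCommGroup V] [NormedSpace ℝ V]
    [FiniteDimensional ℝ V] [MeasurableSpace V] [BorelSpace V] (μ : Measure V)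
    [μ.IsAddHaarMeasure] {q₁ q₂ : ℝ≥0∞} (hq₁ : q₁ ≠ 0) (h12 : q₁ ≤ q₂) {s r : ℝ}
    (hr : s + finrank ℝ V * (1 / q₁.toReal - 1 / q₂.toReal) < r) :
    ∃ C : ℝ≥0∞, C ≠ ∞ ∧ ∀ F : V → ℝ≥0∞, supLpSize q₁ μ (fun ω => F ω * bracketWeight s ω) ≤
      C * supLpSize q₂ μ (fun ω => F ω * bracketWeight r ω) := by
  rcases h12.eq_or_lt with rfl | hlt
  · refine ⟨1, ENNReal.one_ne_top, fun F => ?_⟩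
    rw [one_mul]
    exact supLpSize_mono fun ω => mul_le_mul_right (bracketWeight_mono (by linarith) ω) _
  have h1 : q₁ ≠ ∞ := hlt.ne_top
  have hp1 : 0 < q₁.toReal := ENNReal.toReal_pos hq₁ h1
  have hF : ∀ (F : V → ℝ≥0∞) ω, (F ω * bracketWeight s ω) ^ q₁.toReal =
      (F ω * bracketWeight r ω) ^ q₁.toReal * bracketWeight (-((r - s) * q₁.toReal)) ω := by
    intro F ω
    rw [← neg_mul, ← bracketWeight_rpow hp1.le, ← ENNReal.mul_rpow_of_nonneg _ _ hp1.le,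
      mul_assoc, ← bracketWeight_add, neg_sub, add_sub_cancel]
  by_cases h2 : q₂ = ∞
  · have hI : ∫⁻ ω, bracketWeight (-((r - s) * q₁.toReal)) ω ∂μ ≠ ∞ := by
      refine lintegral_bracketWeight_ne_top ?_
      rw [h2, ENNReal.toReal_top, div_zero, sub_zero, mul_one_div] at hr
      exact (div_lt_iff₀ hp1).1 (by linarith)
    refine ⟨(∫⁻ ω, bracketWeight (-((r - s) * q₁.toReal)) ω ∂μ) ^ (1 / q₁.toReal),
      ENNReal.rpow_ne_top_of_nonneg (by positivity) hI, fun F => ?_⟩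
    rw [supLpSize, if_neg h1, supLpSize, if_pos h2]
    set J := ⨆ ω, F ω * bracketWeight r ω
    have hJ : J = (J ^ q₁.toReal) ^ (1 / q₁.toReal) := by
      rw [← ENNReal.rpow_mul, mul_one_div_cancel hp1.ne', ENNReal.rpow_one]
    rw [hJ, ← ENNReal.mul_rpow_of_nonneg _ _ (by positivity)]
    gcongr
    rw [← lintegral_mul_const _ (measurable_bracketWeight _)]
    refine lintegral_mono fun ω => ?_
    rw [hF, mul_comm]
    gcongr
    exact le_iSup (fun ω => F ω * bracketWeight r ω) ω
  · have hp12 : q₁.toReal < q₂.toReal := ENNReal.toReal_strict_mono h2 hlt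
    have hp2 := hp1.trans hp12
    have hpq : (q₂.toReal / q₁.toReal).HolderConjugate (q₂.toReal / (q₂.toReal - q₁.toReal)) := by
      have h3 : q₂.toReal - q₁.toReal ≠ 0 := by linarith
      refine Real.holderConjugate_iff.2 ⟨(one_lt_div hp1).2 hp12, ?_⟩
      field_simp
      ring
    set p := q₂.toReal / q₁.toReal with hp
    set p' := q₂.toReal / (q₂.toReal - q₁.toReal) with hp'
    have hI : ∫⁻ ω, bracketWeight (-((r - s) * q₁.toReal)) ω ^ p' ∂μ ≠ ∞ := by
      simp_rw [bracketWeight_rpow hpq.symm.pos.le, neg_mul]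
      refine lintegral_bracketWeight_ne_top ?_
      have h3 : 0 < q₂.toReal - q₁.toReal := by linarith
      rw [hp', mul_div_assoc', lt_div_iff₀ h3]
      have h4 : finrank ℝ V * (1 / q₁.toReal - 1 / q₂.toReal) < r - s := by linarith
      have h5 := mul_lt_mul_of_pos_right h4 (mul_pos hp1 hp2)
      refine lt_of_eq_of_lt ?_ (h5.trans_eq (by ring))
      field_simp
    refine ⟨(1 + ∫⁻ ω, bracketWeight (-((r - s) * q₁.toReal)) ω ^ p' ∂μ) ^ (1 / q₁.toReal),
      ENNReal.rpow_ne_top_of_nonneg (by positivity) (by simp [hI]), fun F => ?_⟩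
    rw [supLpSize, if_neg h1, supLpSize, if_neg h2]
    simp_rw [hF F]
    refine (ENNReal.rpow_le_rpow (lintegral_mul_le_rpow_mul_one_add hpq _
      (measurable_bracketWeight _) hI) (by positivity)).trans_eq ?_
    rw [ENNReal.mul_rpow_of_nonneg _ _ (by positivity), mul_comm, ← ENNReal.rpow_mul]
    simp_rw [← ENNReal.rpow_mul]
    rw [hp, mul_div_cancel₀ _ hp1.ne', one_div_div, div_mul_div_cancel₀' hp1.ne']

end MixedSize

section Embedding

open SchwartzMap Module

variable {V : Type*} [NormedAddCommGroup V] [InnerProductSpace ℝ V] [FiniteDimensional ℝ V]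
  [MeasurableSpace V] [BorelSpace V]

/-- The weighted short-time Fourier transform of `f` along the window `b`, maximized over the
space variable. -/
def stftMaximal (b : 𝓢(V, ℂ)) (m u : ℝ) (f : 𝓢(V, ℂ) →L[ℝ] ℂ) (ω : V) : ℝ≥0∞ :=
  ⨆ x, ‖f (tfShift b x ω)‖ₑ * bracketWeight m x * bracketWeight u ω

lemma exists_enorm_apply_tfShift_mul_decay_le (b : 𝓢(V, ℂ)) (f : 𝓢(V, ℂ) →L[ℝ] ℂ) :
    ∃ A : ℕ, ∃ B : ℝ≥0∞, B ≠ ∞ ∧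
      ∀ x ω, ‖f (tfShift b x ω)‖ₑ * (decayWeight x ^ A * decayWeight ω ^ A) ≤ B := by
  obtain ⟨M, C, hC, hf⟩ := f.exists_norm_le_schwartzNorm
  obtain ⟨A, C', hC', hb⟩ := exists_schwartzNorm_tfShift_le b M
  refine ⟨A, ENNReal.ofReal (C * C'), ENNReal.ofReal_ne_top, fun x ω => ?_⟩
  have h : ‖f (tfShift b x ω)‖ ≤ C * C' * ((1 + ‖x‖) ^ A * (1 + ‖ω‖) ^ A) := by
    rw [mul_assoc]
    exact (hf _).trans (mul_le_mul_of_nonneg_left (hb x ω) hC.le)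
  have h' := ENNReal.ofReal_le_ofReal h
  rw [ofReal_norm, ENNReal.ofReal_mul (mul_nonneg hC.le hC'.le),
    ENNReal.ofReal_mul (pow_nonneg (by positivity) A)] at h'
  calc _ ≤ ENNReal.ofReal (C * C') * (ENNReal.ofReal ((1 + ‖x‖) ^ A) *
        ENNReal.ofReal ((1 + ‖ω‖) ^ A)) * (decayWeight x ^ A * decayWeight ω ^ A) := by gcongr
    _ = ENNReal.ofReal (C * C') * (ENNReal.ofReal ((1 + ‖x‖) ^ A) * decayWeight x ^ A) *
        (ENNReal.ofReal ((1 + ‖ω‖) ^ A) * decayWeight ω ^ A) := by ring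
    _ = _ := by simp [ofReal_pow_mul_decay_pow]

lemma exists_stftMaximal_le_mul_supLpSize {b : 𝓢(V, ℂ)} (hb : b ≠ 0) {q : ℝ≥0∞} (hq : q ≠ 0)
    (m u : ℝ) : ∃ C : ℝ≥0∞, C ≠ ∞ ∧ ∀ f ω,
      stftMaximal b m u f ω ≤ C * supLpSize q volume (stftMaximal b m u f) := by
  by_cases hqt : q = ∞
  · refine ⟨1, ENNReal.one_ne_top, fun f ω => ?_⟩
    rw [one_mul, supLpSize, if_pos hqt]
    exact le_iSup _ ω
  have hp : 0 < q.toReal := ENNReal.toReal_pos hq hqt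
  choose C hC hCf using exists_enorm_apply_tfShift_le hb
  obtain ⟨K, hK⟩ := exists_bracketWeight_mul_decay_le (V := V) m
  obtain ⟨K', hK'⟩ := exists_bracketWeight_mul_decay_le (V := V) u
  have hU : ∀ f : 𝓢(V, ℂ) →L[ℝ] ℂ, IsLocallyControlled volume (fun L N => C (L + K) (N + K'))
      fun x ω => ‖f (tfShift b x ω)‖ₑ * bracketWeight m x * bracketWeight u ω := fun f =>
    IsLocallyControlled.mul_weight (U := fun x ω => ‖f (tfShift b x ω)‖ₑ)
      (fun L N x ω₀ => hCf L N f x ω₀) hK hK' (bracketWeight_ne_top m) (bracketWeight_ne_top u)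
  simp only [supLpSize, if_neg hqt]
  rcases le_or_gt q.toReal 1 with h1 | h1
  · refine ⟨C (0 + K) (0 + K') ^ (1 / q.toReal),
      ENNReal.rpow_ne_top_of_nonneg (by positivity) (hC _ _), fun f ω => iSup_le fun x => ?_⟩
    obtain ⟨A, B, hB, hAB⟩ := exists_enorm_apply_tfShift_mul_decay_le b f
    refine (hU f).le_rpow_lintegral_of_le_one (fun L N => hC _ _) (A := A + K + K')
      (B := B * bracketWeight m (0 : V) * bracketWeight u (0 : V))
      (ENNReal.mul_ne_top (ENNReal.mul_ne_top hB (bracketWeight_ne_top m _))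
        (bracketWeight_ne_top u _)) (fun x ω => ?_) hp h1 x ω
    have hx := hK x 0
    have hω := hK' ω 0
    rw [zero_sub, decay_neg] at hx hω
    have hx1 : decayWeight x ^ K' ≤ 1 := pow_le_one₀ bot_le (decay_le_one x)
    have hω1 : decayWeight ω ^ K ≤ 1 := pow_le_one₀ bot_le (decay_le_one ω)
    calc _ = ‖f (tfShift b x ω)‖ₑ * (decayWeight x ^ A * decayWeight ω ^ A) *
          (bracketWeight m x * decayWeight x ^ K) * (bracketWeight u ω * decayWeight ω ^ K') *
          (decayWeight x ^ K' * decayWeight ω ^ K) := by ring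
      _ ≤ B * bracketWeight m (0 : V) * bracketWeight u (0 : V) * (1 * 1) := by
        gcongr
        exact hAB x ω
      _ = _ := by ring
  · refine ⟨_, ?_, fun f ω => iSup_le fun x =>
      (hU f).le_rpow_lintegral_of_one_lt (lintegral_decay_pow_ne_top V) h1 x ω⟩
    exact ENNReal.mul_ne_top (hC _ _) (by simp [lintegral_decay_pow_ne_top])

theorem exists_supLpSize_stftMaximal_le {b : 𝓢(V, ℂ)} (hb : b ≠ 0) {q₁ q₂ : ℝ≥0∞} (hq₁ : q₁ ≠ 0)
    (h12 : q₁ ≤ q₂) (m u : ℝ) : ∃ C : ℝ≥0∞, C ≠ ∞ ∧ ∀ f,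
      supLpSize q₂ volume (stftMaximal b m u f) ≤
        C * supLpSize q₁ volume (stftMaximal b m u f) := by
  obtain ⟨C, hC, h⟩ := exists_stftMaximal_le_mul_supLpSize hb hq₁ m u
  refine ⟨max 1 C, by simp [hC], fun f => supLpSize_le_of_le hq₁ h12 (le_max_left _ _) fun ω =>
    (h f ω).trans ?_⟩
  gcongr
  exact le_max_right _ _

end Embedding

section Transfer

open SchwartzMap

variable {d : ℕ}

/-- The window `conj g`, transported to Euclidean space. -/
def euclideanWindow (g : 𝓢(Fin d → ℝ, ℂ)) : 𝓢(EuclideanSpace ℝ (Fin d), ℂ) :=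
  compCLMOfContinuousLinearEquiv ℝ (EuclideanSpace.equiv (Fin d) ℝ) (conjCLM (Fin d → ℝ) g)

lemma euclideanWindow_apply (g : 𝓢(Fin d → ℝ, ℂ)) (y : EuclideanSpace ℝ (Fin d)) :
    euclideanWindow g y = (starRingEnd ℂ) (g (WithLp.ofLp y)) := rfl

lemma euclideanWindow_ne_zero {g : 𝓢(Fin d → ℝ, ℂ)} (hg : g ≠ 0) : euclideanWindow g ≠ 0 := by
  refine fun h => hg ?_
  ext y
  have h1 : euclideanWindow g (WithLp.toLp 2 y) = 0 := by rw [h]; rfl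
  simpa [euclideanWindow_apply] using h1

/-- Functionals on Schwartz functions on `Fin d → ℝ`, transported to Euclidean space. -/
def euclideanFunctional (f : 𝓢(Fin d → ℝ, ℂ) →L[ℝ] ℂ) :
    𝓢(EuclideanSpace ℝ (Fin d), ℂ) →L[ℝ] ℂ :=
  f ∘L compCLMOfContinuousLinearEquiv ℝ (EuclideanSpace.equiv (Fin d) ℝ).symm

lemma euclideanFunctional_tfShift {g : 𝓢(Fin d → ℝ, ℂ)}
    {Φ : (Fin d → ℝ) → (Fin d → ℝ) → 𝓢(Fin d → ℝ, ℂ)}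
    (hΦ : ∀ x ω y, Φ x ω y =
      Complex.exp (-(2 * π * Complex.I * (∑ i, ω i * y i))) * (starRingEnd ℂ) (g (y - x)))
    (f : 𝓢(Fin d → ℝ, ℂ) →L[ℝ] ℂ) (x ω : EuclideanSpace ℝ (Fin d)) :
    euclideanFunctional f (tfShift (euclideanWindow g) x ω) =
      f (Φ (WithLp.ofLp x) (WithLp.ofLp ω)) := by
  refine congrArg f ?_
  ext y
  change tfShift (euclideanWindow g) x ω (WithLp.toLp 2 y) = _
  rw [tfShift_apply, euclideanWindow_apply, hΦ]
  congr 3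
  simp [PiLp.inner_apply, mul_comm]
  ring

lemma ofReal_jb_rpow (m : ℝ) (x : EuclideanSpace ℝ (Fin d)) :
    ENNReal.ofReal (jb (WithLp.ofLp x) ^ m) = bracketWeight m x := by
  rw [bracketWeight, EuclideanSpace.real_norm_sq_eq, jb]

lemma modNorm_eq_supLpSize {g : 𝓢(Fin d → ℝ, ℂ)}
    {Φ : (Fin d → ℝ) → (Fin d → ℝ) → 𝓢(Fin d → ℝ, ℂ)}
    (hΦ : ∀ x ω y, Φ x ω y =
      Complex.exp (-(2 * π * Complex.I * (∑ i, ω i * y i))) * (starRingEnd ℂ) (g (y - x)))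
    (q : ℝ≥0∞) (m u : ℝ) (f : 𝓢(Fin d → ℝ, ℂ) →L[ℝ] ℂ) :
    modNorm q m u (fun x ω => f (Φ x ω)) =
      supLpSize q volume (stftMaximal (euclideanWindow g) m u (euclideanFunctional f)) := by
  let e := EuclideanSpace.equiv (Fin d) ℝ
  have hW : ∀ ω : EuclideanSpace ℝ (Fin d),
      stftMaximal (euclideanWindow g) m u (euclideanFunctional f) ω =
        ⨆ x, (‖f (Φ x (WithLp.ofLp ω))‖₊ : ℝ≥0∞) * ENNReal.ofReal (jb x ^ m) *
          ENNReal.ofReal (jb (WithLp.ofLp ω) ^ u) := fun ω => by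
    rw [stftMaximal]
    refine e.surjective.iSup_congr _ fun x => ?_
    rw [euclideanFunctional_tfShift hΦ, ← ofReal_jb_rpow, ← ofReal_jb_rpow]
    rfl
  unfold modNorm supLpSize
  split_ifs with hq
  · refine (e.surjective.iSup_congr _ fun ω => ?_).symm
    rw [hW]
    rfl
  · congr 1
    rw [← (PiLp.volume_preserving_ofLp (Fin d)).lintegral_comp_emb
      (MeasurableEquiv.toLp 2 (Fin d → ℝ)).symm.measurableEmbedding]
    refine lintegral_congr fun ω => ?_
    rw [hW, ← ENNReal.mul_rpow_of_nonneg _ _ ENNReal.toReal_nonneg, ENNReal.iSup_mul]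

lemma stftMaximal_eq_mul (b : 𝓢(EuclideanSpace ℝ (Fin d), ℂ)) (m u : ℝ)
    (f : 𝓢(EuclideanSpace ℝ (Fin d), ℂ) →L[ℝ] ℂ) :
    stftMaximal b m u f =
      fun ω => (⨆ x, ‖f (tfShift b x ω)‖ₑ * bracketWeight m x) * bracketWeight u ω := by
  ext ω
  rw [stftMaximal, ENNReal.iSup_mul]

end Transfer

/-- Embeddings of weighted modulation spaces:
for `0 < q₁ ≤ q₂ ≤ ∞` and `r > s + d(1/q₁ - 1/q₂)`,
`M^{∞,q₁}_{⟨·⟩^m⊗⟨·⟩^r} ↪ M^{∞,q₂}_{⟨·⟩^m⊗⟨·⟩^r} ↪ M^{∞,q₁}_{⟨·⟩^m⊗⟨·⟩^s}`.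
Tempered distributions `f` are continuous linear functionals on the Schwartz space,
and `V_g f(x,ω) = f(conj (M_ω T_x g))`; the Schwartz test functions `conj (M_ω T_x g)`
are provided by the witness family `Φ`. -/
theorem modulation_embeddings (d : ℕ) (q₁ q₂ : ℝ≥0∞) (hq₁ : q₁ ≠ 0) (h12 : q₁ ≤ q₂)
    (m s r : ℝ) (hr : r > s + d * (1 / q₁.toReal - 1 / q₂.toReal))
    (g : SchwartzMap (Fin d → ℝ) ℂ) (hg : g ≠ 0)
    (Φ : (Fin d → ℝ) → (Fin d → ℝ) → SchwartzMap (Fin d → ℝ) ℂ)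
    (hΦ : ∀ x ω y, Φ x ω y =
      Complex.exp (-(2 * π * Complex.I * (∑ i, ω i * y i))) * (starRingEnd ℂ) (g (y - x))) :
    ∃ C₁ C₂ : ℝ≥0∞, C₁ ≠ ⊤ ∧ C₂ ≠ ⊤ ∧
      ∀ f : SchwartzMap (Fin d → ℝ) ℂ →L[ℝ] ℂ,
        modNorm q₂ m r (fun x ω => f (Φ x ω)) ≤ C₁ * modNorm q₁ m r (fun x ω => f (Φ x ω)) ∧
        modNorm q₁ m s (fun x ω => f (Φ x ω)) ≤ C₂ * modNorm q₂ m r (fun x ω => f (Φ x ω)) := by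
  have hb := euclideanWindow_ne_zero hg
  obtain ⟨C₁, hC₁, h₁⟩ := exists_supLpSize_stftMaximal_le hb hq₁ h12 m r
  obtain ⟨C₂, hC₂, h₂⟩ := exists_supLpSize_bracketWeight_le
    (volume : Measure (EuclideanSpace ℝ (Fin d))) hq₁ h12 (s := s) (r := r)
    (by rwa [finrank_euclideanSpace_fin])
  refine ⟨C₁, C₂, hC₁, hC₂, fun f => ?_⟩
  simp only [modNorm_eq_supLpSize hΦ]
  refine ⟨h₁ _, ?_⟩
  rw [stftMaximal_eq_mul, stftMaximal_eq_mul]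
  exact h₂ _
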